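/- arXiv:2201.00852 — 3 statements merged into one kernel-verified Lean document; each statement's English description precedes it below -/
import Mathlib

section
/- Let f : [0,∞) → ℝ be continuous. The following are equivalent: (i) the kernel ((x,u),(y,v)) ↦ f(‖x−y‖² + ‖u−v‖²) − f(‖u−v‖²) − f(‖x−y‖²) + f(0) on (ℝ^d×ℝ^{d'})×(ℝ^d×ℝ^{d'}) is positive definite independent for every d, d' ∈ ℕ; (ii) the kernel ((x,u),(y,v)) ↦ f(‖x−y‖² + ‖u−v‖²) is positive definite independent for every d, d' ∈ ℕ; (iii) f(t) = a₀ + a₁t + a₂t² + ∫_{(0,∞)} (e^{−rt} − e₂(r)ω₂(rt))(1+r²)/r² dσ(r) for real scalars a₀, a₁, a₂ with a₂ ≥ 0 and a finite nonnegative Radon measure σ on (0,∞); (iv) f ∈ C^∞((0,∞)) and f'' is completely monotone on (0,∞). -/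
open MeasureTheory Set Finset

noncomputable section

/-- A symmetric kernel `𝔍 : (X × Y) × (X × Y) → ℝ` is positive definite independent (PDI). -/
def IsPDI {X Y : Type*} (J : X × Y → X × Y → ℝ) : Prop :=
  ∀ (n m : ℕ) (x : Fin n → X) (y : Fin m → Y) (c : Fin n → Fin m → ℝ),
    (∀ k, ∑ i, c i k = 0) → (∀ i, ∑ k, c i k = 0) →
    0 ≤ ∑ i, ∑ j, ∑ k, ∑ l, c i k * c j l * J (x i, y k) (x j, y l)

/-- The sign-reversed forward difference `t ↦ f t - f (t + h)`. -/
def negDiff {A : Type*} [Add A] (h : A) (f : A → ℝ) : A → ℝ := fun t => f t - f (t + h)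

/-- The quadratic form of a four-index array attached to a matrix of coefficients. -/
def quadForm {ι κ : Type*} [Fintype ι] [Fintype κ] (c : ι → κ → ℝ) (g : ι → ι → κ → κ → ℝ) : ℝ :=
  ∑ i, ∑ j, ∑ k, ∑ l, c i k * c j l * g i j k l

section QuadForm

variable {ι κ : Type*} [Fintype ι] [Fintype κ] (c : ι → κ → ℝ)

lemma quadForm_add (g g' : ι → ι → κ → κ → ℝ) :
    quadForm c (fun i j k l => g i j k l + g' i j k l) = quadForm c g + quadForm c g' := by
  simp only [quadForm, mul_add, Finset.sum_add_distrib]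

lemma quadForm_sub (g g' : ι → ι → κ → κ → ℝ) :
    quadForm c (fun i j k l => g i j k l - g' i j k l) = quadForm c g - quadForm c g' := by
  simp only [quadForm, mul_sub, Finset.sum_sub_distrib]

lemma quadForm_mul_left (a : ℝ) (g : ι → ι → κ → κ → ℝ) :
    quadForm c (fun i j k l => a * g i j k l) = a * quadForm c g := by
  simp only [quadForm, Finset.mul_sum]
  refine Finset.sum_congr rfl fun i _ => Finset.sum_congr rfl fun j _ =>
    Finset.sum_congr rfl fun k _ => Finset.sum_congr rfl fun l _ => by ring

lemma quadForm_eq_sum_prod (g : ι → ι → κ → κ → ℝ) :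
    quadForm c g = ∑ p : ι × κ, ∑ q : ι × κ, c p.1 p.2 * c q.1 q.2 * g p.1 q.1 p.2 q.2 := by
  simp only [quadForm, Fintype.sum_prod_type]
  refine Finset.sum_congr rfl fun i _ => ?_
  rw [Finset.sum_comm]

lemma quadForm_swap (g : ι → ι → κ → κ → ℝ) :
    quadForm c (fun i j k l => g j i l k) = quadForm c g := by
  rw [quadForm_eq_sum_prod, quadForm_eq_sum_prod, Finset.sum_comm]
  refine Finset.sum_congr rfl fun p _ => Finset.sum_congr rfl fun q _ => by ring

lemma quadForm_transpose (g : κ → κ → ι → ι → ℝ) :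
    quadForm c (fun i j k l => g k l i j) = quadForm (fun k i => c i k) g := by
  rw [quadForm_eq_sum_prod, quadForm_eq_sum_prod, ← (Equiv.prodComm κ ι).sum_comp]
  refine Finset.sum_congr rfl fun p _ => ?_
  rw [← (Equiv.prodComm κ ι).sum_comp]
  rfl

variable {c}

lemma quadForm_const_fst (hι : ∀ k, ∑ i, c i k = 0) (g : ι → κ → κ → ℝ) :
    quadForm c (fun _ j k l => g j k l) = 0 := by
  unfold quadForm
  rw [Finset.sum_comm]
  refine Finset.sum_eq_zero fun j _ => ?_
  rw [Finset.sum_comm]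
  refine Finset.sum_eq_zero fun k _ => ?_
  rw [Finset.sum_comm]
  refine Finset.sum_eq_zero fun l _ => ?_
  simp_rw [mul_assoc, ← Finset.sum_mul, hι, zero_mul]

lemma quadForm_const_snd (hι : ∀ k, ∑ i, c i k = 0) (g : ι → κ → κ → ℝ) :
    quadForm c (fun i _ k l => g i k l) = 0 := by
  rw [← quadForm_swap]
  exact quadForm_const_fst hι fun j k l => g j l k

lemma quadForm_const_trd (hκ : ∀ i, ∑ k, c i k = 0) (g : ι → ι → κ → ℝ) :
    quadForm c (fun i j _ l => g i j l) = 0 := by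
  rw [quadForm_transpose c fun _ l i j => g i j l]
  exact quadForm_const_fst hκ fun l i j => g i j l

lemma quadForm_const_fth (hκ : ∀ i, ∑ k, c i k = 0) (g : ι → ι → κ → ℝ) :
    quadForm c (fun i j k _ => g i j k) = 0 := by
  rw [quadForm_transpose c fun k _ i j => g i j k]
  exact quadForm_const_snd hκ fun k i j => g i j k

lemma quadForm_gram_mul_gram_nonneg {E F : Type*} [NormedAddCommGroup E] [InnerProductSpace ℝ E]
    [NormedAddCommGroup F] [InnerProductSpace ℝ F] (c : ι → κ → ℝ) (x : ι → E) (y : κ → F) :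
    0 ≤ quadForm c (fun i j k l => inner ℝ (x i) (x j) * inner ℝ (y k) (y l)) := by
  rw [quadForm_eq_sum_prod]
  have h := ((Matrix.posSemidef_gram ℝ fun p : ι × κ => x p.1).hadamard
    (Matrix.posSemidef_gram ℝ fun p : ι × κ => y p.2)).dotProduct_mulVec_nonneg
      (fun p => c p.1 p.2)
  simp only [dotProduct, Matrix.mulVec, Matrix.hadamard_apply, Matrix.gram_apply, star_trivial,
    Pi.star_apply, Finset.mul_sum] at h
  refine h.trans_eq ?_
  refine Finset.sum_congr rfl fun p _ => Finset.sum_congr rfl fun q _ => by ring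

lemma quadForm_sq_nonneg {E F : Type*} [NormedAddCommGroup E] [InnerProductSpace ℝ E]
    [NormedAddCommGroup F] [InnerProductSpace ℝ F] (hι : ∀ k, ∑ i, c i k = 0)
    (hκ : ∀ i, ∑ k, c i k = 0) (x : ι → E) (y : κ → F) :
    0 ≤ quadForm c (fun i j k l => (‖x i - x j‖ ^ 2 + ‖y k - y l‖ ^ 2) ^ 2) := by
  have key : quadForm c (fun i j k l => (‖x i - x j‖ ^ 2 + ‖y k - y l‖ ^ 2) ^ 2)
      = 8 * quadForm c (fun i j k l => inner ℝ (x i) (x j) * inner ℝ (y k) (y l)) := by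
    have h : (fun i j k l => (‖x i - x j‖ ^ 2 + ‖y k - y l‖ ^ 2) ^ 2) = fun i j k l =>
        ‖x i - x j‖ ^ 4 + ‖y k - y l‖ ^ 4 + 2 * ‖x i‖ ^ 2 * ‖y k - y l‖ ^ 2
          + 2 * ‖x j‖ ^ 2 * ‖y k - y l‖ ^ 2 - 4 * inner ℝ (x i) (x j) * ‖y k‖ ^ 2
          - 4 * inner ℝ (x i) (x j) * ‖y l‖ ^ 2
          + 8 * (inner ℝ (x i) (x j) * inner ℝ (y k) (y l)) := by
      funext i j k l
      have e1 := norm_sub_sq_real (x i) (x j)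
      have e2 := norm_sub_sq_real (y k) (y l)
      linear_combination (2 * ‖y k - y l‖ ^ 2) * e1 - 4 * inner ℝ (x i) (x j) * e2
    rw [h, quadForm_add, quadForm_sub, quadForm_sub, quadForm_add, quadForm_add, quadForm_add,
      quadForm_mul_left, quadForm_const_trd hκ fun i j _ => ‖x i - x j‖ ^ 4,
      quadForm_const_fst hι fun _ k l => ‖y k - y l‖ ^ 4,
      quadForm_const_snd hι fun i k l => 2 * ‖x i‖ ^ 2 * ‖y k - y l‖ ^ 2,
      quadForm_const_fst hι fun j k l => 2 * ‖x j‖ ^ 2 * ‖y k - y l‖ ^ 2,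
      quadForm_const_fth hκ fun i j k => 4 * inner ℝ (x i) (x j) * ‖y k‖ ^ 2,
      quadForm_const_trd hκ fun i j l => 4 * inner ℝ (x i) (x j) * ‖y l‖ ^ 2]
    ring
  rw [key]
  exact mul_nonneg (by norm_num) (quadForm_gram_mul_gram_nonneg c x y)

lemma quadForm_affine {E F : Type*} [NormedAddCommGroup E] [NormedAddCommGroup F]
    (hι : ∀ k, ∑ i, c i k = 0) (hκ : ∀ i, ∑ k, c i k = 0) (x : ι → E) (y : κ → F) (a b : ℝ) :
    quadForm c (fun i j k l => a + b * (‖x i - x j‖ ^ 2 + ‖y k - y l‖ ^ 2)) = 0 := by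
  have h : (fun i j k l => a + b * (‖x i - x j‖ ^ 2 + ‖y k - y l‖ ^ 2)) = fun i j k l =>
      (a + b * ‖x i - x j‖ ^ 2) + b * ‖y k - y l‖ ^ 2 := by
    funext i j k l; ring
  rw [h, quadForm_add, quadForm_const_trd hκ fun i j _ => a + b * ‖x i - x j‖ ^ 2,
    quadForm_const_fst hι fun _ k l => b * ‖y k - y l‖ ^ 2, add_zero]

end QuadForm

/-! ### Gaussian kernels -/

lemma sum_mul_exp_neg_norm_sq_nonneg {ι E : Type*} [Fintype ι] [NormedAddCommGroup E]
    [InnerProductSpace ℝ E] {r : ℝ} (hr : 0 ≤ r) (z : ι → E) (c : ι → ℝ) :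
    0 ≤ ∑ p, ∑ q, c p * c q * Real.exp (-r * ‖z p - z q‖ ^ 2) := by
  have hpow : ∀ n : ℕ, (Matrix.of fun p q => inner ℝ (z p) (z q) ^ n).PosSemidef := by
    intro n
    induction n with
    | zero =>
      simpa [Matrix.vecMulVec] using Matrix.posSemidef_vecMulVec_self_star (fun _ : ι => (1 : ℝ))
    | succ n ih =>
      have e : (Matrix.of fun p q => inner ℝ (z p) (z q) ^ (n + 1)) =
          (Matrix.of fun p q => inner ℝ (z p) (z q) ^ n).hadamard (Matrix.gram ℝ z) := by
        ext p q
        simp [pow_succ, Matrix.gram]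
      rw [e]
      exact ih.hadamard (Matrix.posSemidef_gram ℝ z)
  have hsum : HasSum (fun n : ℕ => ∑ p, ∑ q,
      (c p * Real.exp (-r * ‖z p‖ ^ 2)) * (c q * Real.exp (-r * ‖z q‖ ^ 2)) *
        ((2 * r * inner ℝ (z p) (z q)) ^ n / n.factorial))
      (∑ p, ∑ q, c p * c q * Real.exp (-r * ‖z p - z q‖ ^ 2)) := by
    refine hasSum_sum fun p _ => hasSum_sum fun q _ => ?_
    have h1 : c p * c q * Real.exp (-r * ‖z p - z q‖ ^ 2) =
        (c p * Real.exp (-r * ‖z p‖ ^ 2)) * (c q * Real.exp (-r * ‖z q‖ ^ 2)) *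
          Real.exp (2 * r * inner ℝ (z p) (z q)) := by
      have : -r * ‖z p - z q‖ ^ 2
          = -r * ‖z p‖ ^ 2 + -r * ‖z q‖ ^ 2 + 2 * r * inner ℝ (z p) (z q) := by
        rw [norm_sub_sq_real]; ring
      rw [this, Real.exp_add, Real.exp_add]; ring
    rw [h1]
    refine HasSum.mul_left _ ?_
    rw [Real.exp_eq_exp_ℝ]
    exact NormedSpace.expSeries_div_hasSum_exp _
  refine hsum.nonneg fun n => ?_
  have h := (hpow n).dotProduct_mulVec_nonneg (fun p => c p * Real.exp (-r * ‖z p‖ ^ 2))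
  simp only [dotProduct, Matrix.mulVec, Matrix.of_apply, star_trivial,
    Pi.star_apply, Finset.mul_sum] at h
  have h2 : 0 ≤ (2 * r) ^ n / n.factorial := by positivity
  refine (mul_nonneg h2 h).trans_eq ?_
  simp only [Finset.mul_sum]
  refine Finset.sum_congr rfl fun p _ => Finset.sum_congr rfl fun q _ => ?_
  rw [mul_pow]; ring

lemma quadForm_exp_nonneg {ι κ E F : Type*} [Fintype ι] [Fintype κ] [NormedAddCommGroup E]
    [InnerProductSpace ℝ E] [NormedAddCommGroup F] [InnerProductSpace ℝ F] {r : ℝ} (hr : 0 ≤ r)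
    (c : ι → κ → ℝ) (x : ι → E) (y : κ → F) :
    0 ≤ quadForm c (fun i j k l => Real.exp (-r * (‖x i - x j‖ ^ 2 + ‖y k - y l‖ ^ 2))) := by
  rw [quadForm_eq_sum_prod]
  have h := sum_mul_exp_neg_norm_sq_nonneg hr
    (fun p : ι × κ => WithLp.toLp 2 (x p.1, y p.2)) (fun p => c p.1 p.2)
  simpa [WithLp.prod_norm_sq_eq_of_L2] using h

/-! ### Radial kernels on all Euclidean spaces -/

/-- `f (‖x - y‖ ^ 2 + ‖u - v‖ ^ 2)` is PDI on all pairs of Euclidean spaces. -/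
def RadialPDI (f : ℝ → ℝ) : Prop :=
  ∀ d d' : ℕ, IsPDI (fun p q : EuclideanSpace ℝ (Fin d) × EuclideanSpace ℝ (Fin d') =>
    f (‖p.1 - q.1‖ ^ 2 + ‖p.2 - q.2‖ ^ 2))

lemma RadialPDI.quadForm_nonneg {f : ℝ → ℝ} (hf : RadialPDI f) {ι κ E F : Type*}
    [Fintype ι] [Fintype κ] [NormedAddCommGroup E] [InnerProductSpace ℝ E]
    [FiniteDimensional ℝ E] [NormedAddCommGroup F] [InnerProductSpace ℝ F]
    [FiniteDimensional ℝ F] {c : ι → κ → ℝ} (hι : ∀ k, ∑ i, c i k = 0)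
    (hκ : ∀ i, ∑ k, c i k = 0) (x : ι → E) (y : κ → F) :
    0 ≤ quadForm c (fun i j k l => f (‖x i - x j‖ ^ 2 + ‖y k - y l‖ ^ 2)) := by
  let eE := (stdOrthonormalBasis ℝ E).repr
  let eF := (stdOrthonormalBasis ℝ F).repr
  let eι := (Fintype.equivFin ι).symm
  let eκ := (Fintype.equivFin κ).symm
  have h := hf _ _ _ _ (fun a => eE (x (eι a))) (fun b => eF (y (eκ b)))
    (fun a b => c (eι a) (eκ b))
    (fun b => by rw [eι.sum_comp fun i => c i (eκ b)]; exact hι _)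
    (fun a => by rw [eκ.sum_comp fun k => c (eι a) k]; exact hκ _)
  simp only [← map_sub, LinearIsometryEquiv.norm_map] at h
  refine h.trans_eq ?_
  unfold quadForm
  rw [← eι.sum_comp]
  refine Finset.sum_congr rfl fun a _ => ?_
  rw [← eι.sum_comp]
  refine Finset.sum_congr rfl fun a' _ => ?_
  rw [← eκ.sum_comp]
  refine Finset.sum_congr rfl fun b _ => ?_
  rw [← eκ.sum_comp]

lemma RadialPDI.weightedSum {f : ℝ → ℝ} (hf : RadialPDI f) {α G : Type*} [Fintype α]
    [NormedAddCommGroup G] [InnerProductSpace ℝ G] [FiniteDimensional ℝ G] (w : α → ℝ)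
    (z : α → G) :
    RadialPDI (fun t => ∑ a, ∑ b, w a * w b * f (t + ‖z a - z b‖ ^ 2)) := by
  intro d d' n m x y c hι hκ
  have h := hf.quadForm_nonneg (c := fun (p : Fin n × α) k => w p.2 * c p.1 k)
    (fun k => by
      simp_rw [Fintype.sum_prod_type_right, ← Finset.mul_sum, hι, mul_zero, Finset.sum_const_zero])
    (fun p => by rw [← Finset.mul_sum, hκ, mul_zero])
    (fun p => WithLp.toLp 2 (x p.1, z p.2)) y
  refine h.trans_eq ?_
  simp only [quadForm, Fintype.sum_prod_type, WithLp.prod_norm_sq_eq_of_L2, WithLp.sub_fst,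
    WithLp.sub_snd]
  refine Finset.sum_congr rfl fun i _ => ?_
  rw [Finset.sum_comm]
  refine Finset.sum_congr rfl fun j _ => ?_
  simp only [Finset.mul_sum]
  rw [Finset.sum_comm_cycle]
  refine Finset.sum_congr rfl fun k _ => ?_
  rw [Finset.sum_comm_cycle]
  refine Finset.sum_congr rfl fun l _ => Finset.sum_congr rfl fun a _ =>
    Finset.sum_congr rfl fun b _ => ?_
  change _ * f (‖x i - x j‖ ^ 2 + ‖z a - z b‖ ^ 2 + ‖y k - y l‖ ^ 2) = _
  ring_nf

lemma RadialPDI.negDiff {f : ℝ → ℝ} (hf : RadialPDI f) {h : ℝ} (hh : 0 ≤ h) :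
    RadialPDI (negDiff h f) := by
  have key := hf.weightedSum ![(1 : ℝ), -1] ![0, √h]
  intro d d' n m x y c hι hκ
  have := key d d' n m x y c hι hκ
  simp only [Fin.sum_univ_two, Matrix.cons_val_zero, Matrix.cons_val_one, sub_self,
    zero_sub, sub_zero, neg_sq, Real.norm_eq_abs, sq_abs, Real.sq_sqrt hh] at this
  have h2 : 2 * 0 ≤ 2 * quadForm c fun i j k l =>
      _root_.negDiff h f (‖x i - x j‖ ^ 2 + ‖y k - y l‖ ^ 2) := by
    rw [mul_zero, ← quadForm_mul_left]
    refine this.trans_eq ?_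
    unfold quadForm _root_.negDiff
    refine Finset.sum_congr rfl fun i _ => Finset.sum_congr rfl fun j _ =>
      Finset.sum_congr rfl fun k _ => Finset.sum_congr rfl fun l _ => by ring_nf
  exact le_of_mul_le_mul_left h2 two_pos

lemma nonneg_of_forall_natCast_mul {a b : ℝ} (h : ∀ N : ℕ, 0 ≤ a + N * b) : 0 ≤ b := by
  by_contra! hb
  obtain ⟨N, hN⟩ := exists_nat_gt (a / -b)
  rw [div_lt_iff₀ (by linarith)] at hN
  linarith [h N]

lemma RadialPDI.shift {f : ℝ → ℝ} (hf : RadialPDI f) {h : ℝ} (hh : 0 ≤ h) :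
    RadialPDI (fun t => f (t + h)) := by
  intro d d' n m x y c hι hκ
  refine nonneg_of_forall_natCast_mul
    (a := quadForm c fun i j k l => f (‖x i - x j‖ ^ 2 + ‖y k - y l‖ ^ 2)) fun N => ?_
  have key := hf.weightedSum (fun _ : Fin (N + 1) => (1 : ℝ))
    (fun a => EuclideanSpace.single a √(h / 2)) d d' n m x y c hι hκ
  have hdist : ∀ a b : Fin (N + 1), ‖EuclideanSpace.single a √(h / 2) -
      EuclideanSpace.single b √(h / 2)‖ ^ 2 = if b = a then 0 else h := by
    intro a b
    split_ifs with hab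
    · simp [hab]
    · rw [norm_sub_sq_real]
      simp only [PiLp.norm_single, Real.norm_eq_abs, sq_abs, EuclideanSpace.inner_single_left,
        PiLp.single_apply, Ne.symm hab, if_false, mul_zero, sub_zero, add_halves,
        Real.sq_sqrt (div_nonneg hh two_pos.le)]
  have hval : ∀ t, ∑ a : Fin (N + 1), ∑ b : Fin (N + 1), (1 : ℝ) * 1 *
      f (t + ‖EuclideanSpace.single a √(h / 2) - EuclideanSpace.single b √(h / 2)‖ ^ 2)
      = (N + 1) * (f t + N * f (t + h)) := by
    intro t
    have : ∀ a b : Fin (N + 1), (1 : ℝ) * 1 * f (t + ‖EuclideanSpace.single a √(h / 2) -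
        EuclideanSpace.single b √(h / 2)‖ ^ 2)
        = f (t + h) + if b = a then f t - f (t + h) else 0 := by
      intro a b
      rw [hdist]
      split_ifs <;> simp
    simp only [this, Finset.sum_add_distrib, Finset.sum_ite_eq', Finset.sum_const,
      Finset.card_univ, Fintype.card_fin, Finset.mem_univ, if_true, nsmul_eq_mul]
    push_cast
    ring
  simp only [hval] at key
  change 0 ≤ quadForm c fun i j k l => ((N : ℝ) + 1) * (f (‖x i - x j‖ ^ 2 + ‖y k - y l‖ ^ 2)
    + N * f (‖x i - x j‖ ^ 2 + ‖y k - y l‖ ^ 2 + h)) at key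
  rw [quadForm_mul_left, quadForm_add, quadForm_mul_left] at key
  exact nonneg_of_mul_nonneg_right key (by positivity)

lemma RadialPDI.negDiff_two_nonneg {f : ℝ → ℝ} (hf : RadialPDI f) {h t : ℝ} (hh : 0 ≤ h)
    (ht : 0 ≤ t) : 0 ≤ (_root_.negDiff h)^[2] f t := by
  have key := (hf.shift ht).quadForm_nonneg (c := !![(1 : ℝ), -1; -1, 1])
    (by simp [Fin.forall_fin_two]) (by simp [Fin.forall_fin_two]) ![0, √h] ![0, √h]
  simp [quadForm, Real.sq_sqrt hh, sq_abs] at key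
  simp only [Function.iterate_succ, Function.iterate_zero, Function.comp, id, _root_.negDiff]
  ring_nf at key ⊢
  linarith

lemma RadialPDI.iterate_negDiff_nonneg {f : ℝ → ℝ} (hf : RadialPDI f) (n : ℕ) {h t : ℝ}
    (hh : 0 ≤ h) (ht : 0 ≤ t) : 0 ≤ (_root_.negDiff h)^[n + 2] f t := by
  induction n generalizing f with
  | zero => exact hf.negDiff_two_nonneg hh ht
  | succ n ih => exact ih (hf.negDiff hh)

lemma radialPDI_of_second_difference {f : ℝ → ℝ} :
    (∀ d d' : ℕ, IsPDI (fun p q : EuclideanSpace ℝ (Fin d) × EuclideanSpace ℝ (Fin d') =>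
      f (‖p.1 - q.1‖ ^ 2 + ‖p.2 - q.2‖ ^ 2) - f (‖p.2 - q.2‖ ^ 2) - f (‖p.1 - q.1‖ ^ 2) + f 0))
      ↔ RadialPDI f := by
  refine forall_congr' fun d => forall_congr' fun d' => forall_congr' fun n =>
    forall_congr' fun m => forall_congr' fun x => forall_congr' fun y => forall_congr' fun c =>
    forall_congr' fun hι => forall_congr' fun hκ => ?_
  change 0 ≤ quadForm c (fun i j k l => f (‖x i - x j‖ ^ 2 + ‖y k - y l‖ ^ 2)
    - f (‖y k - y l‖ ^ 2) - f (‖x i - x j‖ ^ 2) + f 0) ↔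
    0 ≤ quadForm c (fun i j k l => f (‖x i - x j‖ ^ 2 + ‖y k - y l‖ ^ 2))
  rw [quadForm_add, quadForm_sub, quadForm_sub,
    quadForm_const_fst hι fun _ k l => f (‖y k - y l‖ ^ 2),
    quadForm_const_trd hκ fun i j _ => f (‖x i - x j‖ ^ 2),
    quadForm_const_fst hι fun _ _ _ => f 0, sub_zero, sub_zero, add_zero]

/-! ### Sequences of successive derivatives on the half-line -/

lemma iteratedDeriv_eq_of_hasDerivAt {F : ℕ → ℝ → ℝ}
    (hF : ∀ n t, 0 < t → HasDerivAt (F n) (F (n + 1) t) t) {f : ℝ → ℝ}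
    (hf : ∀ t, 0 < t → f t = F 0 t) (n : ℕ) : ∀ t, 0 < t → iteratedDeriv n f t = F n t := by
  induction n with
  | zero => simpa using hf
  | succ n ih =>
    intro t ht
    have hev : iteratedDeriv n f =ᶠ[nhds t] F n := by
      filter_upwards [Ioi_mem_nhds ht] with s hs using ih s hs
    rw [iteratedDeriv_succ, hev.deriv_eq, (hF n t ht).deriv]

lemma contDiffOn_of_hasDerivAt {F : ℕ → ℝ → ℝ}
    (hF : ∀ n t, 0 < t → HasDerivAt (F n) (F (n + 1) t) t) {f : ℝ → ℝ}
    (hf : ∀ t, 0 < t → f t = F 0 t) : ContDiffOn ℝ ((⊤ : ℕ∞) : WithTop ℕ∞) f (Set.Ioi 0) := by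
  refine contDiffOn_of_differentiableOn_deriv fun m _ => ?_
  have hEq : ∀ t ∈ Set.Ioi (0 : ℝ), iteratedDerivWithin m f (Set.Ioi 0) t = F m t := fun t ht =>
    (iteratedDerivWithin_of_isOpen isOpen_Ioi ht).trans (iteratedDeriv_eq_of_hasDerivAt hF hf m t ht)
  exact DifferentiableOn.congr
    (fun t ht => (hF m t ht).differentiableAt.differentiableWithinAt) hEq

lemma hasDerivAt_iteratedDeriv_of_contDiffOn {f : ℝ → ℝ}
    (hf : ContDiffOn ℝ ((⊤ : ℕ∞) : WithTop ℕ∞) f (Set.Ioi 0)) (n : ℕ) {t : ℝ} (ht : 0 < t) :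
    HasDerivAt (iteratedDeriv n f) (iteratedDeriv (n + 1) f t) t := by
  have h := (hf.differentiableOn_iteratedDerivWithin (m := n) (by exact_mod_cast ENat.natCast_lt_top n)
    isOpen_Ioi.uniqueDiffOn).differentiableAt (Ioi_mem_nhds ht)
  have hev : iteratedDeriv n f =ᶠ[nhds t] iteratedDerivWithin n f (Set.Ioi 0) := by
    filter_upwards [Ioi_mem_nhds ht] with s hs using (iteratedDerivWithin_of_isOpen isOpen_Ioi hs).symm
  rw [iteratedDeriv_succ]
  exact (h.congr_of_eventuallyEq hev).hasDerivAt

lemma negDiff_two_nonneg_of_convexOn {f : ℝ → ℝ} (hf : ConvexOn ℝ (Set.Ioi 0) f) {h t : ℝ}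
    (hh : 0 < h) (ht : 0 < t) : 0 ≤ (negDiff h)^[2] f t := by
  have hm : t + h + h ∈ Set.Ioi (0 : ℝ) := Set.mem_Ioi.2 (by linarith)
  have := hf.2 ht hm (one_half_pos (α := ℝ)).le one_half_pos.le (add_halves 1)
  simp only [smul_eq_mul] at this
  rw [show 1 / 2 * t + 1 / 2 * (t + h + h) = t + h by ring] at this
  simp only [Function.iterate_succ, Function.iterate_zero, Function.comp, id, negDiff]
  linarith

lemma iterate_negDiff_nonneg_of_hasDerivAt {F : ℕ → ℝ → ℝ}
    (hF : ∀ n t, 0 < t → HasDerivAt (F n) (F (n + 1) t) t)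
    (hs : ∀ n t, 0 < t → 0 ≤ (-1 : ℝ) ^ n * F (n + 2) t) (n : ℕ) {h t : ℝ} (hh : 0 < h)
    (ht : 0 < t) : 0 ≤ (negDiff h)^[n + 2] (F 0) t := by
  induction n generalizing F with
  | zero =>
    refine negDiff_two_nonneg_of_convexOn ?_ hh ht
    refine convexOn_of_hasDerivWithinAt2_nonneg (f' := F 1) (f'' := F 2) (convex_Ioi 0)
      (fun s hs => (hF 0 s hs).continuousAt.continuousWithinAt) ?_ ?_ ?_
    · intro s hs
      rw [interior_Ioi] at hs ⊢
      exact (hF 0 s hs).hasDerivWithinAt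
    · intro s hs
      rw [interior_Ioi] at hs ⊢
      exact (hF 1 s hs).hasDerivWithinAt
    · intro s hs'
      rw [interior_Ioi] at hs'
      simpa using hs 0 s hs'
  | succ n ih =>
    refine ih (F := fun m => negDiff h (F m)) (fun m s hs' => ?_) (fun m s hs' => ?_)
    · exact (hF m s hs').sub ((hF m (s + h) (by linarith)).comp_add_const s h)
    · have hd : ∀ u, 0 < u → HasDerivAt (fun u => (-1 : ℝ) ^ m * F (m + 2) u)
          ((-1 : ℝ) ^ m * F (m + 3) u) u := fun u hu => (hF (m + 2) u hu).const_mul _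
      have hanti : AntitoneOn (fun u => (-1 : ℝ) ^ m * F (m + 2) u) (Set.Ioi 0) := by
        refine antitoneOn_of_deriv_nonpos (convex_Ioi 0)
          (fun u hu => (hd u hu).continuousAt.continuousWithinAt) ?_ ?_
        · rw [interior_Ioi]
          exact fun u hu => (hd u hu).differentiableAt.differentiableWithinAt
        · rw [interior_Ioi]
          intro u hu
          rw [(hd u hu).deriv]
          have := hs (m + 1) u hu
          rw [pow_succ] at this
          linarith
      have := hanti (Set.mem_Ioi.2 hs') (Set.mem_Ioi.2 (by linarith : 0 < s + h)) (by linarith)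
      simp only [negDiff, mul_sub]
      linarith

/-! ### The integral kernel -/

/-- The successive `t`-derivatives of `(e^{-rt} - e₂(r) ω₂(rt)) (1 + r²) / r²`. -/
def kernelDeriv : ℕ → ℝ → ℝ → ℝ
  | 0, r, t => (Real.exp (-r * t) - (Real.exp (-r) * (1 + r)) * (1 - r * t)) * ((1 + r ^ 2) / r ^ 2)
  | 1, r, t => (-r * Real.exp (-r * t) + (Real.exp (-r) * (1 + r)) * r) * ((1 + r ^ 2) / r ^ 2)
  | n + 2, r, t => (-r) ^ (n + 2) * Real.exp (-r * t) * ((1 + r ^ 2) / r ^ 2)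

lemma measurable_kernelDeriv (n : ℕ) (t : ℝ) : Measurable fun r => kernelDeriv n r t := by
  match n with
  | 0 => unfold kernelDeriv; fun_prop
  | 1 => unfold kernelDeriv; fun_prop
  | n + 2 => unfold kernelDeriv; fun_prop

lemma hasDerivAt_kernelDeriv (n : ℕ) (r t : ℝ) :
    HasDerivAt (kernelDeriv n r) (kernelDeriv (n + 1) r t) t := by
  have h1 : HasDerivAt (fun t => Real.exp (-r * t)) (-r * Real.exp (-r * t)) t := by
    have := ((hasDerivAt_id t).const_mul (-r)).exp
    simpa [mul_comm] using this
  match n with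
  | 0 =>
    have h2 : HasDerivAt (fun t => 1 - r * t) (-r) t := by
      simpa using ((hasDerivAt_id t).const_mul r).const_sub 1
    have := (h1.sub (h2.const_mul (Real.exp (-r) * (1 + r)))).mul_const ((1 + r ^ 2) / r ^ 2)
    refine this.congr_deriv ?_
    simp only [kernelDeriv]; ring
  | 1 =>
    have := ((h1.const_mul (-r)).add_const (Real.exp (-r) * (1 + r) * r)).mul_const
      ((1 + r ^ 2) / r ^ 2)
    refine this.congr_deriv ?_
    simp only [kernelDeriv]; ring
  | n + 2 =>
    have := (h1.const_mul ((-r) ^ (n + 2))).mul_const ((1 + r ^ 2) / r ^ 2)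
    refine this.congr_deriv ?_
    simp only [kernelDeriv]; ring

lemma pow_mul_exp_neg_le {r c : ℝ} (hr : 0 ≤ r) (hc : 0 < c) (n : ℕ) :
    r ^ n * Real.exp (-r * c) ≤ n.factorial / c ^ n := by
  have h := Real.pow_div_factorial_le_exp _ (mul_nonneg hr hc.le) n
  rw [div_le_iff₀ (by positivity), mul_pow] at h
  rw [neg_mul, Real.exp_neg, ← div_eq_mul_inv, div_le_div_iff₀ (Real.exp_pos _) (by positivity)]
  linarith

lemma abs_kernelDeriv_add_two_le {r c t : ℝ} (hr : 0 < r) (hc : 0 < c) (ht : c ≤ t) (n : ℕ) :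
    |kernelDeriv (n + 2) r t| ≤ n.factorial / c ^ n + (n + 2).factorial / c ^ (n + 2) := by
  have hE : Real.exp (-r * t) ≤ Real.exp (-r * c) := Real.exp_le_exp.2 (by nlinarith)
  have e : |kernelDeriv (n + 2) r t| = (r ^ n + r ^ (n + 2)) * Real.exp (-r * t) := by
    simp only [kernelDeriv]
    rw [abs_mul, abs_mul, abs_pow, abs_neg, abs_of_pos hr, abs_of_pos (Real.exp_pos _),
      abs_of_pos (by positivity)]
    field_simp
    ring
  rw [e, add_mul]
  refine add_le_add ?_ ?_
  · exact (mul_le_mul_of_nonneg_left hE (by positivity)).trans (pow_mul_exp_neg_le hr.le hc n)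
  · exact (mul_le_mul_of_nonneg_left hE (by positivity)).trans (pow_mul_exp_neg_le hr.le hc _)

lemma abs_kernelDeriv_one_le {r c C t : ℝ} (hr : 0 < r) (hc : 0 < c) (hc1 : c ≤ 1)
    (ht : c ≤ t) (htC : t ≤ C) :
    |kernelDeriv 1 r t| ≤ 3 + (1 + 2 / c ^ 2) * (C + 1) := by
  have hb : ∀ s ∈ Set.Ici c, ‖kernelDeriv 2 r s‖ ≤ 1 + 2 / c ^ 2 := fun s hs => by
    simpa using abs_kernelDeriv_add_two_le hr hc hs 0
  have hmv := (convex_Ici c).norm_image_sub_le_of_norm_hasDerivWithin_le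
    (fun s _ => (hasDerivAt_kernelDeriv 1 r s).hasDerivWithinAt) hb (Set.mem_Ici.2 hc1)
    (Set.mem_Ici.2 ht)
  have h1 : |kernelDeriv 1 r 1| ≤ 3 := by
    have e : kernelDeriv 1 r 1 = r ^ 0 * Real.exp (-r * 1) + r ^ 2 * Real.exp (-r * 1) := by
      simp only [kernelDeriv]; field_simp; ring
    have e0 : Real.exp (-r * 1) ≤ 1 := Real.exp_le_one_iff.2 (by linarith)
    have e2 := pow_mul_exp_neg_le hr.le one_pos 2
    rw [e, abs_of_nonneg (by positivity)]
    norm_num [Nat.factorial] at e2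
    rw [pow_zero, one_mul]
    norm_num
    rw [mul_one] at e0
    linarith
  have h3 : ‖t - 1‖ ≤ C + 1 := by
    rw [Real.norm_eq_abs, abs_le]; constructor <;> linarith
  have h4 : (1 + 2 / c ^ 2) * ‖t - 1‖ ≤ (1 + 2 / c ^ 2) * (C + 1) :=
    mul_le_mul_of_nonneg_left h3 (by positivity)
  rw [Real.norm_eq_abs] at hmv
  have := abs_sub_abs_le_abs_sub (kernelDeriv 1 r t) (kernelDeriv 1 r 1)
  linarith

lemma exists_bound_kernelDeriv_succ (n : ℕ) {c : ℝ} (C : ℝ) (hc : 0 < c) :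
    ∃ B, ∀ r, 0 < r → ∀ t ∈ Set.Ioo c C, |kernelDeriv (n + 1) r t| ≤ B := by
  match n with
  | 0 =>
    exact ⟨_, fun r hr t ht => abs_kernelDeriv_one_le hr (lt_min hc one_pos) (min_le_right c 1)
      ((min_le_left c 1).trans ht.1.le) ht.2.le⟩
  | n + 1 => exact ⟨_, fun r hr t ht => abs_kernelDeriv_add_two_le hr hc ht.1.le n⟩

lemma abs_kernelDeriv_zero_le {r t : ℝ} (hr : 0 < r) (ht : 0 ≤ t) :
    |kernelDeriv 0 r t| ≤ 4 * (1 + t + t ^ 2) := by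
  have hexp : ∀ s : ℝ, 0 ≤ s → Real.exp (-s) * (1 + s) ≤ 1 := fun s hs => by
    have h1 := Real.add_one_le_exp s
    have h2 : Real.exp (-s) * Real.exp s = 1 := by rw [← Real.exp_add]; simp
    nlinarith [Real.exp_pos (-s)]
  have hrt : 0 ≤ r * t := by positivity
  have hE0 := Real.exp_pos (-(r * t))
  have hE1 := hexp _ hrt
  have hE2 := Real.add_one_le_exp (-(r * t))
  have he0 := Real.exp_pos (-r)
  have he1 := hexp _ hr.le
  have he2 := Real.add_one_le_exp (-r)
  have he3 := Real.quadratic_le_exp_of_nonneg hr.le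
  have he4 : Real.exp (-r) * Real.exp r = 1 := by rw [← Real.exp_add]; simp
  simp only [kernelDeriv, neg_mul]
  set E := Real.exp (-(r * t))
  set e := Real.exp (-r)
  rw [abs_mul, abs_of_pos (by positivity : 0 < (1 + r ^ 2) / r ^ 2)]
  rcases le_total r 1 with h | h
  · have hA : |E - e * (1 + r) * (1 - r * t)| ≤ r ^ 2 * (1 + t + t ^ 2) := by
      have a1 : E - 1 + r * t ≤ r ^ 2 * t ^ 2 := by nlinarith
      have a2 : 1 - e * (1 + r) ≤ r ^ 2 := by nlinarith
      have a3 : |1 - r * t| ≤ 1 + t := by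
        rw [abs_le]; constructor <;> nlinarith
      calc |E - e * (1 + r) * (1 - r * t)|
          = |(E - 1 + r * t) + (1 - e * (1 + r)) * (1 - r * t)| := by ring_nf
        _ ≤ |E - 1 + r * t| + |1 - e * (1 + r)| * |1 - r * t| := by
            rw [← abs_mul]; exact abs_add_le _ _
        _ ≤ r ^ 2 * t ^ 2 + r ^ 2 * (1 + t) := by
            rw [abs_of_nonneg (by linarith : 0 ≤ E - 1 + r * t),
              abs_of_nonneg (by linarith : 0 ≤ 1 - e * (1 + r))]
            gcongr
        _ = _ := by ring
    calc |E - e * (1 + r) * (1 - r * t)| * ((1 + r ^ 2) / r ^ 2)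
        ≤ (r ^ 2 * (1 + t + t ^ 2)) * ((1 + r ^ 2) / r ^ 2) := by gcongr
      _ = (1 + t + t ^ 2) * (1 + r ^ 2) := by field_simp
      _ ≤ (1 + t + t ^ 2) * 4 := by gcongr; nlinarith
      _ = _ := by ring
  · have hw : (1 + r ^ 2) / r ^ 2 ≤ 2 := by
      rw [div_le_iff₀ (by positivity)]; nlinarith
    have hE3 : E ≤ 1 := by nlinarith
    have he5 : e * (r + r ^ 2) ≤ 2 := by nlinarith
    have hA : |E - e * (1 + r) * (1 - r * t)| ≤ 2 * (1 + t) := by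
      have p : 0 ≤ e * (1 + r) := by positivity
      have q : e * (1 + r) * (r * t) ≤ 2 * t := by nlinarith
      have q' : 0 ≤ e * (1 + r) * (r * t) := by positivity
      rw [abs_le]; constructor <;> nlinarith
    calc |E - e * (1 + r) * (1 - r * t)| * ((1 + r ^ 2) / r ^ 2) ≤ (2 * (1 + t)) * 2 := by gcongr
      _ ≤ _ := by nlinarith

lemma integrable_kernelDeriv_zero (σ : Measure (Set.Ioi (0 : ℝ))) [IsFiniteMeasure σ] {t : ℝ}
    (ht : 0 ≤ t) : Integrable (fun r : Set.Ioi (0 : ℝ) => kernelDeriv 0 r t) σ :=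
  Integrable.of_bound ((measurable_kernelDeriv 0 t).comp measurable_subtype_coe).aestronglyMeasurable
    (4 * (1 + t + t ^ 2)) (Filter.Eventually.of_forall fun r => abs_kernelDeriv_zero_le r.2 ht)

lemma hasDerivAt_integral_kernelDeriv (σ : Measure (Set.Ioi (0 : ℝ))) [IsFiniteMeasure σ] (n : ℕ)
    {t : ℝ} (ht : 0 < t) :
    Integrable (fun r : Set.Ioi (0 : ℝ) => kernelDeriv n r t) σ ∧
    HasDerivAt (fun t => ∫ r : Set.Ioi (0 : ℝ), kernelDeriv n r t ∂σ)
      (∫ r : Set.Ioi (0 : ℝ), kernelDeriv (n + 1) r t ∂σ) t := by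
  have hmeas : ∀ n t, AEStronglyMeasurable (fun r : Set.Ioi (0 : ℝ) => kernelDeriv n r t) σ :=
    fun n t => ((measurable_kernelDeriv n t).comp measurable_subtype_coe).aestronglyMeasurable
  have key : ∀ n, Integrable (fun r : Set.Ioi (0 : ℝ) => kernelDeriv n r t) σ →
      Integrable (fun r : Set.Ioi (0 : ℝ) => kernelDeriv (n + 1) r t) σ ∧
      HasDerivAt (fun t => ∫ r : Set.Ioi (0 : ℝ), kernelDeriv n r t ∂σ)
        (∫ r : Set.Ioi (0 : ℝ), kernelDeriv (n + 1) r t ∂σ) t := by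
    intro n hn
    obtain ⟨B, hB⟩ := exists_bound_kernelDeriv_succ n (t + 1) (half_pos ht)
    exact hasDerivAt_integral_of_dominated_loc_of_deriv_le
      (Ioo_mem_nhds (half_lt_self ht) (lt_add_one t))
      (F := fun t (r : Set.Ioi (0 : ℝ)) => kernelDeriv n r t)
      (F' := fun t (r : Set.Ioi (0 : ℝ)) => kernelDeriv (n + 1) r t) (bound := fun _ => B)
      (Filter.Eventually.of_forall fun s => hmeas n s) hn (hmeas _ _)
      (Filter.Eventually.of_forall fun r s hs => hB r r.2 s hs) (integrable_const B)
      (Filter.Eventually.of_forall fun r s _ => hasDerivAt_kernelDeriv n r s)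
  have hInt : Integrable (fun r : Set.Ioi (0 : ℝ) => kernelDeriv n r t) σ := by
    induction n with
    | zero => exact integrable_kernelDeriv_zero σ ht.le
    | succ n ih => exact (key n ih).1
  exact ⟨hInt, (key n hInt).2⟩

/-! ### Functions given by the integral representation -/

/-- The integral representation of completely monotone functions of order two. -/
def HasLevyRep (f : ℝ → ℝ) : Prop :=
  ∃ (a₀ a₁ a₂ : ℝ) (σ : Measure (Set.Ioi (0 : ℝ))), 0 ≤ a₂ ∧ IsFiniteMeasure σ ∧
    ∀ t : ℝ, 0 ≤ t → f t = a₀ + a₁ * t + a₂ * t ^ 2 + ∫ r : Set.Ioi (0 : ℝ), kernelDeriv 0 r t ∂σ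

lemma HasLevyRep.contDiffOn_and_sign {f : ℝ → ℝ} (hf : HasLevyRep f) :
    ContDiffOn ℝ ((⊤ : ℕ∞) : WithTop ℕ∞) f (Set.Ioi 0) ∧
      ∀ (n : ℕ) (t : ℝ), 0 < t → 0 ≤ (-1 : ℝ) ^ n * iteratedDeriv (n + 2) f t := by
  obtain ⟨a₀, a₁, a₂, σ, ha₂, hσ, hrep⟩ := hf
  let P : ℕ → ℝ → ℝ
    | 0, t => a₀ + a₁ * t + a₂ * t ^ 2
    | 1, t => a₁ + 2 * a₂ * t
    | 2, _ => 2 * a₂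
    | _ + 3, _ => 0
  have hP : ∀ n t, HasDerivAt (P n) (P (n + 1) t) t := by
    intro n t
    match n with
    | 0 =>
      have := (((hasDerivAt_id t).const_mul a₁).const_add a₀).add
        (((hasDerivAt_id t).pow 2).const_mul a₂)
      refine this.congr_deriv ?_
      simp [P]; ring
    | 1 =>
      have := ((hasDerivAt_id t).const_mul (2 * a₂)).const_add a₁
      refine this.congr_deriv ?_
      simp [P]
    | 2 => exact hasDerivAt_const _ _
    | n + 3 => exact hasDerivAt_const _ _
  let F : ℕ → ℝ → ℝ := fun n t => P n t + ∫ r : Set.Ioi (0 : ℝ), kernelDeriv n r t ∂σ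
  have hF : ∀ n t, 0 < t → HasDerivAt (F n) (F (n + 1) t) t := fun n t ht =>
    (hP n t).add (hasDerivAt_integral_kernelDeriv σ n ht).2
  have hf0 : ∀ t, 0 < t → f t = F 0 t := fun t ht => hrep t ht.le
  refine ⟨contDiffOn_of_hasDerivAt hF hf0, fun n t ht => ?_⟩
  rw [iteratedDeriv_eq_of_hasDerivAt hF hf0 _ t ht]
  simp only [F, mul_add]
  refine add_nonneg ?_ ?_
  · match n with
    | 0 => simpa [P] using ha₂
    | n + 1 => simp [P]
  · rw [← integral_const_mul]
    refine integral_nonneg fun r => ?_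
    have hr : (0 : ℝ) < r := r.2
    have : (-1 : ℝ) ^ n * kernelDeriv (n + 2) r t
        = (r : ℝ) ^ (n + 2) * Real.exp (-r * t) * ((1 + (r : ℝ) ^ 2) / (r : ℝ) ^ 2) := by
      simp only [kernelDeriv]
      rw [neg_pow (r : ℝ) (n + 2), pow_add (-1 : ℝ) n 2]
      have : (-1 : ℝ) ^ n * (-1) ^ n = 1 := by rw [← mul_pow]; simp
      linear_combination
        ((r : ℝ) ^ (n + 2) * Real.exp (-r * t) * ((1 + (r : ℝ) ^ 2) / (r : ℝ) ^ 2)) * this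
    simp only [Pi.zero_apply, this]
    positivity

lemma HasLevyRep.radialPDI {f : ℝ → ℝ} (hf : HasLevyRep f) : RadialPDI f := by
  obtain ⟨a₀, a₁, a₂, σ, ha₂, hσ, hrep⟩ := hf
  intro d d' n m x y c hι hκ
  let T : Fin n → Fin n → Fin m → Fin m → ℝ := fun i j k l => ‖x i - x j‖ ^ 2 + ‖y k - y l‖ ^ 2
  have hT : ∀ i j k l, 0 ≤ T i j k l := fun i j k l => by positivity
  change 0 ≤ quadForm c fun i j k l => f (T i j k l)
  simp_rw [hrep _ (hT _ _ _ _)]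
  rw [quadForm_add, quadForm_add, quadForm_affine hι hκ x y, quadForm_mul_left, zero_add]
  refine add_nonneg (mul_nonneg ha₂ (quadForm_sq_nonneg hι hκ x y)) ?_
  have hswap : (quadForm c fun i j k l => ∫ r : Set.Ioi (0 : ℝ), kernelDeriv 0 r (T i j k l) ∂σ)
      = ∫ r : Set.Ioi (0 : ℝ), quadForm c (fun i j k l => kernelDeriv 0 r (T i j k l)) ∂σ := by
    simp only [quadForm_eq_sum_prod]
    have hInt : ∀ p q : Fin n × Fin m, Integrable (fun r : Set.Ioi (0 : ℝ) =>
        c p.1 p.2 * c q.1 q.2 * kernelDeriv 0 r (T p.1 q.1 p.2 q.2)) σ := fun p q =>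
      (integrable_kernelDeriv_zero σ (hT _ _ _ _)).const_mul _
    rw [integral_finsetSum _ fun p _ => integrable_finsetSum _ fun q _ => hInt p q]
    refine Finset.sum_congr rfl fun p _ => ?_
    rw [integral_finsetSum _ fun q _ => hInt p q]
    refine Finset.sum_congr rfl fun q _ => ?_
    rw [integral_const_mul]
  rw [hswap]
  refine integral_nonneg fun r => ?_
  have hr : (0 : ℝ) < r := r.2
  have e : (fun i j k l => kernelDeriv 0 r (T i j k l)) = fun i j k l =>
      ((1 + (r : ℝ) ^ 2) / (r : ℝ) ^ 2) * Real.exp (-r * (‖x i - x j‖ ^ 2 + ‖y k - y l‖ ^ 2)) +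
      (-(Real.exp (-r) * (1 + r) * ((1 + (r : ℝ) ^ 2) / (r : ℝ) ^ 2)) +
        (Real.exp (-r) * (1 + r) * r * ((1 + (r : ℝ) ^ 2) / (r : ℝ) ^ 2)) *
          (‖x i - x j‖ ^ 2 + ‖y k - y l‖ ^ 2)) := by
    funext i j k l
    simp only [kernelDeriv, T]; ring
  simp only [Pi.zero_apply]
  rw [e, quadForm_add, quadForm_mul_left, quadForm_affine hι hκ x y, add_zero]
  exact mul_nonneg (by positivity) (quadForm_exp_nonneg hr.le c x y)

/-! ### The Hausdorff moment problem -/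

lemma eq_sum_choose_mul_negDiff (a : ℕ → ℝ) (N k : ℕ) :
    a k = ∑ i ∈ Finset.range (N + 1), (N.choose i : ℝ) * (negDiff 1)^[N - i] a (k + i) := by
  let E : Module.End ℝ (ℕ → ℝ) := LinearMap.funLeft ℝ ℝ (· + 1)
  have hE : ∀ (i : ℕ) (b : ℕ → ℝ) (k : ℕ), (E ^ i) b k = b (k + i) := by
    intro i
    induction i with
    | zero => simp
    | succ i ih =>
      intro b k
      rw [pow_succ, Module.End.mul_apply, ih]
      rfl
  have hS : ∀ (i : ℕ) (b : ℕ → ℝ), ((1 - E) ^ i) b = (negDiff 1)^[i] b := by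
    intro i b
    rw [Module.End.pow_apply]
    rfl
  have hcomm : Commute E (1 - E) := (Commute.one_right E).sub_right (Commute.refl E)
  have h := congrArg (fun L : Module.End ℝ (ℕ → ℝ) => L a k) (hcomm.add_pow N)
  simp only [add_sub_cancel, one_pow, Module.End.one_apply, LinearMap.sum_apply,
    Finset.sum_apply] at h
  rw [h]
  refine Finset.sum_congr rfl fun i _ => ?_
  rw [← nsmul_eq_mul', LinearMap.smul_apply, Pi.smul_apply, Module.End.mul_apply, hE, hS,
    nsmul_eq_mul]

lemma eq_sum_bernstein_weights (a : ℕ → ℝ) {n k : ℕ} (hk : k ≤ n) :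
    a k = ∑ j ∈ Finset.range (n + 1),
      ((n.choose j : ℝ) * (negDiff 1)^[n - j] a j) * ((j.choose k : ℝ) / n.choose k) := by
  obtain ⟨N, rfl⟩ := Nat.exists_eq_add_of_le hk
  rw [eq_sum_choose_mul_negDiff a N k, add_assoc, Finset.sum_range_add _ k (N + 1),
    Finset.sum_eq_zero (s := Finset.range k), zero_add]
  · refine Finset.sum_congr rfl fun i _ => ?_
    have h := Nat.choose_mul (n := k + N) (k := k + i) (s := k) (Nat.le_add_right _ _)
    rw [Nat.add_sub_cancel_left, Nat.add_sub_cancel_left] at h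
    have h' : ((k + N).choose (k + i) : ℝ) * (k + i).choose k = (k + N).choose k * N.choose i := by
      exact_mod_cast h
    have hpos : ((k + N).choose k : ℝ) ≠ 0 := by
      exact_mod_cast (Nat.choose_pos (Nat.le_add_right k N)).ne'
    rw [show k + N - (k + i) = N - i by omega]
    field_simp
    linear_combination -((negDiff 1)^[N - i] a (k + i)) * h'
  · intro j hj
    rw [Nat.choose_eq_zero_of_lt (Finset.mem_range.1 hj)]
    simp

lemma abs_choose_div_choose_sub_pow_le {n j : ℕ} (hj : j ≤ n) (k : ℕ) (hk : k < n) :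
    |(j.choose k : ℝ) / n.choose k - ((j : ℝ) / n) ^ k| ≤ (k : ℝ) ^ 2 / (n - k) := by
  have hn : (0 : ℝ) < n := by exact_mod_cast (by omega : 0 < n)
  have hjn : (j : ℝ) ≤ n := by exact_mod_cast hj
  have hy0 : (0 : ℝ) ≤ (j : ℝ) / n := by positivity
  have hy1 : (j : ℝ) / n ≤ 1 := (div_le_one hn).2 hjn
  induction k with
  | zero => simp
  | succ k ih =>
    have ih := ih (by omega)
    have hkn : ((k : ℝ) + 1) < n := by exact_mod_cast hk
    have hcn : (0 : ℝ) < n.choose k := by exact_mod_cast Nat.choose_pos (by omega)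
    have hcn' : (0 : ℝ) < n.choose (k + 1) := by exact_mod_cast Nat.choose_pos (by omega)
    have hρ0 : (0 : ℝ) ≤ (j.choose k : ℝ) / n.choose k := by positivity
    have hρ1 : (j.choose k : ℝ) / n.choose k ≤ 1 := by
      rw [div_le_one hcn]; exact_mod_cast Nat.choose_le_choose k hj
    have hn' : (n.choose (k + 1) : ℝ) * (k + 1) = n.choose k * (n - k) := by
      have := Nat.choose_succ_right_eq n k
      rw [← Nat.cast_sub (by omega : k ≤ n)]
      exact_mod_cast this
    have hcoef : (k : ℝ) ^ 2 / (n - k) + k / (n - k) ≤ ((k + 1 : ℕ) : ℝ) ^ 2 / (n - (k + 1 : ℕ)) := by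
      push_cast
      rw [← add_div]
      apply div_le_div₀ (by positivity) (by nlinarith) (by linarith) (by linarith)
    refine le_trans ?_ hcoef
    have hstep : |(j : ℝ) / n| * |(j.choose k : ℝ) / n.choose k - ((j : ℝ) / n) ^ k|
        ≤ (k : ℝ) ^ 2 / (n - k) := by
      rw [abs_of_nonneg hy0]
      exact (mul_le_of_le_one_left (abs_nonneg _) hy1).trans ih
    rcases lt_or_ge j k with hjk | hjk
    · rw [Nat.choose_eq_zero_of_lt hjk] at hstep
      rw [Nat.choose_eq_zero_of_lt (by omega : j < k + 1), pow_succ]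
      have h0 : 0 ≤ (k : ℝ) / (n - k) := div_nonneg (by positivity) (by linarith)
      rw [← abs_mul] at hstep
      have e : ((0 : ℕ) : ℝ) / n.choose (k + 1) - ((j : ℝ) / n) ^ k * (j / n)
          = (j : ℝ) / n * (((0 : ℕ) : ℝ) / n.choose k - ((j : ℝ) / n) ^ k) := by
        push_cast; ring
      rw [e]
      linarith
    · have hkj : (k : ℝ) ≤ j := by exact_mod_cast hjk
      have hj' : (j.choose (k + 1) : ℝ) * (k + 1) = j.choose k * (j - k) := by
        have := Nat.choose_succ_right_eq j k
        rw [← Nat.cast_sub hjk]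
        exact_mod_cast this
      have hnk : (0 : ℝ) < n - k := by linarith
      have hρ : (j.choose (k + 1) : ℝ) / n.choose (k + 1)
          = (j.choose k : ℝ) / n.choose k * ((j - k) / (n - k)) := by
        rw [div_mul_div_comm, div_eq_div_iff hcn'.ne' (mul_pos hcn hnk).ne', ← hn', ← hj']
        ring
      have hfac : |((j : ℝ) - k) / (n - k) - j / n| ≤ k / (n - k) := by
        have e : ((j : ℝ) - k) / (n - k) - j / n = -(k / (n - k) * ((n - j) / n)) := by
          field_simp; ring
        rw [e, abs_neg, abs_of_nonneg (mul_nonneg (by positivity)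
          (div_nonneg (by linarith) hn.le))]
        refine mul_le_of_le_one_right (by positivity) ((div_le_one hn).2 ?_)
        linarith [(Nat.cast_nonneg j : (0 : ℝ) ≤ j)]
      calc |(j.choose (k + 1) : ℝ) / n.choose (k + 1) - ((j : ℝ) / n) ^ (k + 1)|
          = |(j : ℝ) / n * ((j.choose k : ℝ) / n.choose k - ((j : ℝ) / n) ^ k)
            + (j.choose k : ℝ) / n.choose k * (((j : ℝ) - k) / (n - k) - j / n)| := by
            rw [hρ]; congr 1; ring
        _ ≤ |(j : ℝ) / n| * |(j.choose k : ℝ) / n.choose k - ((j : ℝ) / n) ^ k|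
            + |(j.choose k : ℝ) / n.choose k| * |((j : ℝ) - k) / (n - k) - j / n| := by
            rw [← abs_mul, ← abs_mul]; exact abs_add_le _ _
        _ ≤ (k : ℝ) ^ 2 / (n - k) + k / (n - k) := by
            refine add_le_add hstep ?_
            rw [abs_of_nonneg hρ0]
            exact (mul_le_of_le_one_left (abs_nonneg _) hρ1).trans hfac

/-- The discrete measure with Bernstein weights attached to a sequence. -/
def bernsteinMeasure (a : ℕ → ℝ) (n : ℕ) : Measure unitInterval :=
  ∑ j ∈ Finset.range (n + 1), ENNReal.ofReal ((n.choose j : ℝ) * (negDiff 1)^[n - j] a j) •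
    Measure.dirac (Set.projIcc (0 : ℝ) 1 zero_le_one (j / n))

instance (a : ℕ → ℝ) (n : ℕ) : IsFiniteMeasure (bernsteinMeasure a n) := by
  constructor
  simp only [bernsteinMeasure, Measure.coe_finsetSum, Finset.sum_apply, Measure.smul_apply,
    measure_univ, smul_eq_mul, mul_one]
  exact ENNReal.sum_lt_top.2 fun _ _ => ENNReal.ofReal_lt_top

lemma integral_pow_bernsteinMeasure {a : ℕ → ℝ} (ha : ∀ n k, 0 ≤ (negDiff 1)^[n] a k)
    {n : ℕ} (hn : 0 < n) (k : ℕ) : ∫ x, (x : ℝ) ^ k ∂(bernsteinMeasure a n) =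
      ∑ j ∈ Finset.range (n + 1),
        ((n.choose j : ℝ) * (negDiff 1)^[n - j] a j) * ((j : ℝ) / n) ^ k := by
  unfold bernsteinMeasure
  rw [integral_finsetSum_measure]
  · refine Finset.sum_congr rfl fun j hj => ?_
    have hj' : (j : ℝ) ≤ n := by exact_mod_cast Nat.lt_succ_iff.1 (Finset.mem_range.1 hj)
    have hn' : (0 : ℝ) < n := by exact_mod_cast hn
    have hmem : (j : ℝ) / n ∈ Set.Icc (0 : ℝ) 1 := ⟨by positivity, (div_le_one hn').2 hj'⟩
    rw [integral_smul_measure, integral_dirac, Set.projIcc_of_mem _ hmem,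
      ENNReal.toReal_ofReal (mul_nonneg (Nat.cast_nonneg _) (ha _ _)), smul_eq_mul]
  · intro j _
    refine Integrable.smul_measure ?_ ENNReal.ofReal_ne_top
    exact integrable_dirac (by simp)

/-- **Hausdorff moment theorem**, existence part. -/
theorem exists_measure_of_completelyMonotone_seq {a : ℕ → ℝ}
    (ha : ∀ n k, 0 ≤ (negDiff 1)^[n] a k) :
    ∃ μ : Measure unitInterval, IsFiniteMeasure μ ∧ ∀ k, ∫ x, (x : ℝ) ^ k ∂μ = a k := by
  have hw : ∀ n j, 0 ≤ (n.choose j : ℝ) * (negDiff 1)^[n - j] a j :=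
    fun n j => mul_nonneg (Nat.cast_nonneg _) (ha _ _)
  have hmass : ∀ n, ∑ j ∈ Finset.range (n + 1), (n.choose j : ℝ) * (negDiff 1)^[n - j] a j = a 0 :=
    fun n => by simpa using (eq_sum_bernstein_weights a (Nat.zero_le n)).symm
  let μ : ℕ → FiniteMeasure unitInterval := fun n => ⟨bernsteinMeasure a (n + 1), inferInstance⟩
  have hμmass : ∀ n, (μ n).mass = (a 0).toNNReal := by
    intro n
    have h := integral_pow_bernsteinMeasure ha n.succ_pos 0
    simp only [pow_zero, mul_one, hmass, integral_const, smul_eq_mul] at h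
    rw [← h]
    simp [μ, FiniteMeasure.mass, Measure.real, ENNReal.toNNReal]
  have hlim : ∀ k, Filter.Tendsto (fun n => ∫ x, (x : ℝ) ^ k ∂(μ n : Measure unitInterval))
      Filter.atTop (nhds (a k)) := by
    intro k
    rw [tendsto_iff_norm_sub_tendsto_zero]
    have hbound : Filter.Tendsto (fun n : ℕ => a 0 * ((k : ℝ) ^ 2 / (((n + 1 : ℕ) : ℝ) - k)))
        Filter.atTop (nhds 0) := by
      rw [← mul_zero (a 0)]
      refine Filter.Tendsto.const_mul _ (Filter.Tendsto.div_atTop tendsto_const_nhds ?_)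
      exact Filter.tendsto_atTop_add_const_right _ _
        (tendsto_natCast_atTop_atTop.comp (Filter.tendsto_add_atTop_nat 1))
    refine squeeze_zero' (Filter.Eventually.of_forall fun _ => norm_nonneg _) ?_ hbound
    filter_upwards [Filter.eventually_ge_atTop k] with n hn
    change ‖∫ x, (x : ℝ) ^ k ∂(bernsteinMeasure a (n + 1)) - a k‖ ≤ _
    rw [integral_pow_bernsteinMeasure ha n.succ_pos,
      eq_sum_bernstein_weights a (by omega : k ≤ n + 1), ← Finset.sum_sub_distrib,
      ← hmass (n + 1), Finset.sum_mul]
    refine (norm_sum_le _ _).trans (Finset.sum_le_sum fun j hj => ?_)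
    rw [← mul_sub, norm_mul, Real.norm_of_nonneg (hw _ _), norm_sub_rev]
    exact mul_le_mul_of_nonneg_left (abs_choose_div_choose_sub_pow_le
      (Nat.lt_succ_iff.1 (Finset.mem_range.1 hj)) k (by omega)) (hw _ _)
  let U : Ultrafilter ℕ := Ultrafilter.of Filter.atTop
  obtain ⟨ν, -, hν⟩ := isCompact_iff_ultrafilter_le_nhds.1
    (isCompact_setOfPred_finiteMeasure_eq_of_compactSpace unitInterval (a 0).toNNReal) (U.map μ)
    (by
      rw [Filter.le_principal_iff]
      exact Filter.Eventually.of_forall (f := (U : Filter ℕ)) hμmass)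
  have hν' : Filter.Tendsto μ U (nhds ν) := hν
  refine ⟨ν, inferInstance, fun k => ?_⟩
  have h1 := FiniteMeasure.tendsto_iff_forall_integral_tendsto.1 hν'
    (BoundedContinuousFunction.mkOfCompact ⟨fun x : unitInterval => (x : ℝ) ^ k, by fun_prop⟩)
  exact tendsto_nhds_unique h1 ((hlim k).mono_left (Ultrafilter.of_le _))

/-- **Hausdorff moment theorem**, uniqueness part. -/
theorem measure_ext_of_moments {μ ν : Measure unitInterval} [IsFiniteMeasure μ]
    [IsFiniteMeasure ν] (h : ∀ k : ℕ, ∫ x, (x : ℝ) ^ k ∂μ = ∫ x, (x : ℝ) ^ k ∂ν) : μ = ν := by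
  have hcont : ∀ (μ : Measure unitInterval) [IsFiniteMeasure μ],
      Continuous fun φ : C(unitInterval, ℝ) => ∫ x, φ x ∂μ := by
    intro μ _
    have : (fun φ : C(unitInterval, ℝ) => ∫ x, φ x ∂μ)
        = fun φ => ∫ x, (ContinuousMap.toLp 1 μ ℝ φ) x ∂μ := by
      funext φ
      exact integral_congr_ae (ContinuousMap.coeFn_toLp μ φ).symm
    rw [this]
    exact continuous_integral.comp (ContinuousMap.toLp 1 μ ℝ).continuous
  have hclosed : IsClosed {φ : C(unitInterval, ℝ) | ∫ x, φ x ∂μ = ∫ x, φ x ∂ν} :=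
    isClosed_eq (hcont μ) (hcont ν)
  have hpoly : ((polynomialFunctions unitInterval : Subalgebra ℝ C(unitInterval, ℝ)) :
      Set C(unitInterval, ℝ)) ⊆ {φ | ∫ x, φ x ∂μ = ∫ x, φ x ∂ν} := by
    rintro _ ⟨p, -, rfl⟩
    have hp : ∀ (μ : Measure unitInterval) [IsFiniteMeasure μ], ∫ x : unitInterval, p.eval (x : ℝ) ∂μ
        = ∑ i ∈ Finset.range (p.natDegree + 1), p.coeff i * ∫ x, (x : ℝ) ^ i ∂μ := by
      intro μ _
      simp only [Polynomial.eval_eq_sum_range]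
      rw [integral_finsetSum]
      · simp only [integral_const_mul]
      · intro i _
        exact (BoundedContinuousFunction.integrable μ (BoundedContinuousFunction.mkOfCompact
          ⟨fun x : unitInterval => p.coeff i * (x : ℝ) ^ i, by fun_prop⟩))
    change ∫ x : unitInterval, p.eval (x : ℝ) ∂μ = ∫ x : unitInterval, p.eval (x : ℝ) ∂ν
    rw [hp, hp]
    simp only [h]
  refine ext_of_forall_integral_eq_of_IsFiniteMeasure fun φ => ?_
  have hmem : φ.toContinuousMap ∈ (polynomialFunctions unitInterval).topologicalClosure := by
    rw [polynomialFunctions_closure_eq_top']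
    trivial
  exact hclosed.closure_subset_iff.2 hpoly hmem

/-! ### From nonnegative differences to the integral representation -/

lemma iterate_negDiff_sample (g : ℝ → ℝ) (h : ℝ) (n k : ℕ) :
    (negDiff 1)^[n] (fun k : ℕ => g (k * h)) k = (negDiff h)^[n] g (k * h) := by
  induction n generalizing k with
  | zero => rfl
  | succ n ih =>
    rw [Function.iterate_succ_apply', Function.iterate_succ_apply']
    simp only [negDiff, ih]
    push_cast
    rw [add_mul, one_mul]

lemma negDiff_one_eq_sum (g : ℝ → ℝ) {m : ℕ} (hm : 0 < m) (t : ℝ) :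
    negDiff 1 g t = ∑ i ∈ Finset.range m, negDiff (m : ℝ)⁻¹ g (t + i * (m : ℝ)⁻¹) := by
  have hm' : (m : ℝ) ≠ 0 := by exact_mod_cast hm.ne'
  have h := Finset.sum_range_sub' (fun i : ℕ => g (t + i * (m : ℝ)⁻¹)) m
  simp only [Nat.cast_zero, zero_mul, add_zero, mul_inv_cancel₀ hm'] at h
  rw [negDiff, ← h]
  refine Finset.sum_congr rfl fun i _ => ?_
  simp only [negDiff]
  push_cast
  ring_nf

lemma negDiff_one_two_eq_sum (g : ℝ → ℝ) {m : ℕ} (hm : 0 < m) (k : ℕ) :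
    (negDiff 1)^[2] g k = ∑ i ∈ Finset.range m, ∑ j ∈ Finset.range m,
      (negDiff (m : ℝ)⁻¹)^[2] g ((m * k + (i + j) : ℕ) * (m : ℝ)⁻¹) := by
  have hm' : (m : ℝ) ≠ 0 := by exact_mod_cast hm.ne'
  change negDiff 1 (negDiff 1 g) k = _
  rw [negDiff_one_eq_sum _ hm]
  refine Finset.sum_congr rfl fun i _ => ?_
  rw [negDiff, negDiff_one_eq_sum _ hm, negDiff_one_eq_sum _ hm, ← Finset.sum_sub_distrib]
  refine Finset.sum_congr rfl fun j _ => ?_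
  change _ = negDiff (m : ℝ)⁻¹ g _ - negDiff (m : ℝ)⁻¹ g _
  congr 2 <;> (push_cast; field_simp; try ring)

lemma integrable_of_continuous_unitInterval {μ : Measure unitInterval} [IsFiniteMeasure μ]
    {φ : unitInterval → ℝ} (hφ : Continuous φ) : Integrable φ μ :=
  BoundedContinuousFunction.integrable μ (BoundedContinuousFunction.mkOfCompact ⟨φ, hφ⟩)

lemma one_le_geom_sum {x : ℝ} (hx : 0 ≤ x) {m : ℕ} (hm : 0 < m) :
    1 ≤ ∑ i ∈ Finset.range m, x ^ i := by
  have := Finset.single_le_sum (f := fun i => x ^ i) (fun i _ => pow_nonneg hx i)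
    (Finset.mem_range.2 hm)
  simpa using this

/-- The second difference of step `1 / m` at `k / m` of a function whose higher differences are
nonnegative is an integral against a measure that does not depend on `m` and `k`. -/
lemma exists_measure_second_difference {f : ℝ → ℝ}
    (hD : ∀ (n : ℕ) (h t : ℝ), 0 < h → 0 ≤ t → 0 ≤ (negDiff h)^[n + 2] f t) :
    ∃ β : Measure unitInterval, IsFiniteMeasure β ∧ ∀ m k : ℕ, 0 < m →
      (negDiff (m : ℝ)⁻¹)^[2] f (k * (m : ℝ)⁻¹) = ∫ y : unitInterval, ((y : ℝ) ^ (m : ℝ)⁻¹) ^ k /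
        (∑ i ∈ Finset.range m, ((y : ℝ) ^ (m : ℝ)⁻¹) ^ i) ^ 2 ∂β := by
  have hex : ∀ m : ℕ, 0 < m → ∃ μ : Measure unitInterval, IsFiniteMeasure μ ∧
      ∀ k : ℕ, ∫ x, (x : ℝ) ^ k ∂μ = (negDiff (m : ℝ)⁻¹)^[2] f (k * (m : ℝ)⁻¹) := by
    intro m hm
    refine exists_measure_of_completelyMonotone_seq
      (a := fun k => (negDiff (m : ℝ)⁻¹)^[2] f (k * (m : ℝ)⁻¹)) fun n k => ?_
    rw [iterate_negDiff_sample, ← Function.iterate_add_apply]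
    exact hD n _ _ (by positivity) (by positivity)
  obtain ⟨β, hβ, hβm⟩ := hex 1 one_pos
  refine ⟨β, hβ, fun m k hm => ?_⟩
  obtain ⟨μ, hμ, hμm⟩ := hex m hm
  have hS : Continuous fun x : unitInterval => (∑ i ∈ Finset.range m, (x : ℝ) ^ i) ^ 2 := by
    fun_prop
  have hS0 : ∀ x : unitInterval, 0 ≤ (∑ i ∈ Finset.range m, (x : ℝ) ^ i) ^ 2 := fun _ => sq_nonneg _
  have hSm : Measurable fun x : unitInterval =>
      ENNReal.ofReal ((∑ i ∈ Finset.range m, (x : ℝ) ^ i) ^ 2) := by fun_prop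
  have hfin : IsFiniteMeasure (μ.withDensity fun x : unitInterval =>
      ENNReal.ofReal ((∑ i ∈ Finset.range m, (x : ℝ) ^ i) ^ 2)) :=
    isFiniteMeasure_withDensity_ofReal (integrable_of_continuous_unitInterval hS).2
  let pw : unitInterval → unitInterval := fun x => x ^ m
  have hpw : Measurable pw := Continuous.measurable (by fun_prop)
  have hInt : ∀ g : unitInterval → ℝ, Measurable g →
      ∫ y, g y ∂((μ.withDensity fun x : unitInterval =>
        ENNReal.ofReal ((∑ i ∈ Finset.range m, (x : ℝ) ^ i) ^ 2)).map pw) =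
      ∫ x, (∑ i ∈ Finset.range m, (x : ℝ) ^ i) ^ 2 * g (x ^ m) ∂μ := by
    intro g hg
    rw [integral_map hpw.aemeasurable hg.aestronglyMeasurable,
      integral_withDensity_eq_integral_toReal_smul hSm
        (Filter.Eventually.of_forall fun _ => ENNReal.ofReal_lt_top)]
    simp only [ENNReal.toReal_ofReal (hS0 _), smul_eq_mul, pw]
  have hβμ : β = (μ.withDensity fun x : unitInterval =>
      ENNReal.ofReal ((∑ i ∈ Finset.range m, (x : ℝ) ^ i) ^ 2)).map pw := by
    have := Measure.isFiniteMeasure_map (μ.withDensity fun x : unitInterval =>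
      ENNReal.ofReal ((∑ i ∈ Finset.range m, (x : ℝ) ^ i) ^ 2)) pw
    refine measure_ext_of_moments fun l => ?_
    rw [hInt _ (by fun_prop), hβm l]
    simp only [Nat.cast_one, inv_one, mul_one]
    rw [negDiff_one_two_eq_sum f hm]
    simp only [← hμm]
    have hi : ∀ i, Integrable (fun x : unitInterval => (x : ℝ) ^ i) μ := fun i =>
      integrable_of_continuous_unitInterval (by fun_prop)
    simp_rw [← integral_finsetSum (Finset.range m) fun j _ => hi _]
    rw [← integral_finsetSum _ fun i _ => integrable_finsetSum _ fun j _ => hi _]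
    refine integral_congr_ae (Filter.Eventually.of_forall fun x => ?_)
    simp only
    rw [sq, Finset.sum_mul_sum, Finset.sum_mul]
    simp only [Finset.sum_mul]
    refine Finset.sum_congr rfl fun i _ => Finset.sum_congr rfl fun j _ => ?_
    simp only [Set.Icc.coe_pow]
    ring
  rw [hβμ, hInt _ (by fun_prop), ← hμm]
  refine integral_congr_ae (Filter.Eventually.of_forall fun x => ?_)
  have hx : (((x ^ m : unitInterval) : ℝ)) ^ (m : ℝ)⁻¹ = x := by
    rw [Set.Icc.coe_pow, Real.pow_rpow_inv_natCast x.2.1 hm.ne']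
  have h1 := one_le_geom_sum x.2.1 hm
  simp only [hx]
  field_simp

lemma negDiff_two (g : ℝ → ℝ) (h t : ℝ) :
    (negDiff h)^[2] g t = g t - 2 * g (t + h) + g (t + 2 * h) := by
  change (g t - g (t + h)) - (g (t + h) - g (t + h + h)) = _
  rw [add_assoc t h h, ← two_mul]
  ring

lemma continuousOn_iterate_negDiff {f : ℝ → ℝ} (hf : ContinuousOn f (Set.Ici 0)) {h : ℝ}
    (hh : 0 ≤ h) (n : ℕ) : ContinuousOn ((negDiff h)^[n] f) (Set.Ici 0) := by
  induction n with
  | zero => exact hf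
  | succ n ih =>
    rw [Function.iterate_succ_apply']
    refine ih.sub (ih.comp (by fun_prop) fun t ht => ?_)
    exact add_nonneg (Set.mem_Ici.1 ht) hh

lemma iterate_negDiff_nonneg_of_pos {f : ℝ → ℝ} (hf : ContinuousOn f (Set.Ici 0))
    {h : ℝ} (hh : 0 ≤ h) {n : ℕ} (hD : ∀ t, 0 < t → 0 ≤ (negDiff h)^[n] f t) {t : ℝ}
    (ht : 0 ≤ t) : 0 ≤ (negDiff h)^[n] f t := by
  have hc := (continuousOn_iterate_negDiff hf hh n t ht).mono
    (Set.Ioi_subset_Ici ht)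
  exact ge_of_tendsto hc (eventually_nhdsWithin_of_forall fun s hs => hD s (ht.trans_lt hs))

lemma continuousOn_integral_kernelDeriv_zero (σ : Measure (Set.Ioi (0 : ℝ))) [IsFiniteMeasure σ] :
    ContinuousOn (fun t => ∫ r : Set.Ioi (0 : ℝ), kernelDeriv 0 r t ∂σ) (Set.Ici 0) := by
  intro t₀ ht₀
  refine continuousWithinAt_of_dominated (bound := fun _ => 4 * (1 + (t₀ + 1) + (t₀ + 1) ^ 2))
    ?_ ?_ (integrable_const _) ?_
  · exact Filter.Eventually.of_forall fun t =>
      ((measurable_kernelDeriv 0 t).comp measurable_subtype_coe).aestronglyMeasurable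
  · have h1 : ∀ᶠ t in nhdsWithin t₀ (Set.Ici 0), t < t₀ + 1 :=
      nhdsWithin_le_nhds (Iio_mem_nhds (by linarith))
    filter_upwards [self_mem_nhdsWithin, h1] with t ht ht1
    have ht : 0 ≤ t := ht
    refine Filter.Eventually.of_forall fun r => (abs_kernelDeriv_zero_le r.2 ht).trans ?_
    gcongr
  · exact Filter.Eventually.of_forall fun r =>
      (hasDerivAt_kernelDeriv 0 r t₀).continuousAt.continuousWithinAt

lemma eq_affine_of_second_difference_eq_zero {q : ℝ → ℝ} (hq : ContinuousOn q (Set.Ici 0))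
    (h0 : ∀ m k : ℕ, 0 < m → (negDiff (m : ℝ)⁻¹)^[2] q (k * (m : ℝ)⁻¹) = 0) {t : ℝ}
    (ht : 0 ≤ t) : q t = q 0 + (q 1 - q 0) * t := by
  have hlin : ∀ m k : ℕ, 0 < m →
      q (k * (m : ℝ)⁻¹) = q 0 + k * (q (m : ℝ)⁻¹ - q 0) := by
    intro m k hm
    induction k using Nat.twoStepInduction with
    | zero => simp
    | one => simp
    | more k ih1 ih2 =>
      have h := h0 m k hm
      rw [negDiff_two, ih1, show (k : ℝ) * (m : ℝ)⁻¹ + (m : ℝ)⁻¹ = (k + 1 : ℕ) * (m : ℝ)⁻¹ by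
        push_cast; ring, ih2, show (k : ℝ) * (m : ℝ)⁻¹ + 2 * (m : ℝ)⁻¹ = (k + 2 : ℕ) * (m : ℝ)⁻¹ by
        push_cast; ring] at h
      push_cast at h ⊢
      linarith
  have hrat : ∀ m k : ℕ, 0 < m → q (k * (m : ℝ)⁻¹) = q 0 + (q 1 - q 0) * (k * (m : ℝ)⁻¹) := by
    intro m k hm
    have hm' : (m : ℝ) ≠ 0 := by exact_mod_cast hm.ne'
    have h1 := hlin m m hm
    rw [mul_inv_cancel₀ hm'] at h1
    rw [hlin m k hm, h1]
    field_simp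
    ring
  have hlim : Filter.Tendsto (fun m : ℕ => (⌊t * m⌋₊ : ℝ) * (m : ℝ)⁻¹) Filter.atTop (nhds t) :=
    (tendsto_nat_floor_mul_div_atTop ht).comp tendsto_natCast_atTop_atTop
  have hlim' : Filter.Tendsto (fun m : ℕ => (⌊t * m⌋₊ : ℝ) * (m : ℝ)⁻¹) Filter.atTop
      (nhdsWithin t (Set.Ici 0)) :=
    tendsto_nhdsWithin_iff.2 ⟨hlim, Filter.Eventually.of_forall fun m => by
      rw [Set.mem_Ici]; positivity⟩
  have h1 := (hq t ht).tendsto.comp hlim'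
  have h2 : Filter.Tendsto (fun m : ℕ => q 0 + (q 1 - q 0) * ((⌊t * m⌋₊ : ℝ) * (m : ℝ)⁻¹))
      Filter.atTop (nhds (q 0 + (q 1 - q 0) * t)) := (hlim.const_mul _).const_add _
  refine tendsto_nhds_unique h1 (h2.congr' ?_)
  filter_upwards [Filter.eventually_gt_atTop 0] with m hm
  exact (hrat m _ hm).symm

lemma sq_div_le_two {r : ℝ} (hr : 0 < r) :
    r ^ 2 / ((1 + r ^ 2) * (1 - Real.exp (-r)) ^ 2) ≤ 2 := by
  have h1 : r ≤ (1 + r) * (1 - Real.exp (-r)) := by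
    have h := Real.add_one_le_exp r
    have h2 : Real.exp (-r) * (1 + r) ≤ 1 := by
      rw [Real.exp_neg, inv_mul_le_iff₀ (Real.exp_pos r)]
      linarith
    nlinarith
  have h3 : 0 < 1 - Real.exp (-r) := by
    have := Real.exp_lt_one_iff.2 (neg_neg_of_pos hr)
    linarith
  rw [div_le_iff₀ (by positivity)]
  calc r ^ 2 ≤ ((1 + r) * (1 - Real.exp (-r))) ^ 2 := by gcongr
    _ = (1 + r) ^ 2 * (1 - Real.exp (-r)) ^ 2 := by ring
    _ ≤ 2 * (1 + r ^ 2) * (1 - Real.exp (-r)) ^ 2 := by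
      gcongr
      nlinarith [sq_nonneg (1 - r)]
    _ = _ := by ring

lemma negDiff_two_kernelDeriv_zero (r h t : ℝ) : (negDiff h)^[2] (kernelDeriv 0 r) t =
    Real.exp (-r * t) * (1 - Real.exp (-r * h)) ^ 2 * ((1 + r ^ 2) / r ^ 2) := by
  rw [negDiff_two]
  simp only [kernelDeriv]
  rw [show -r * (t + h) = -r * t + -r * h by ring,
    show -r * (t + 2 * h) = -r * t + -r * h + -r * h by ring]
  simp only [Real.exp_add]
  ring

lemma measure_zero_of_second_difference {f : ℝ → ℝ} (hf : ContinuousOn f (Set.Ici 0))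
    {β : Measure unitInterval} [IsFiniteMeasure β] (hβ : ∀ m k : ℕ, 0 < m →
      (negDiff (m : ℝ)⁻¹)^[2] f (k * (m : ℝ)⁻¹) = ∫ y : unitInterval, ((y : ℝ) ^ (m : ℝ)⁻¹) ^ k /
        (∑ i ∈ Finset.range m, ((y : ℝ) ^ (m : ℝ)⁻¹) ^ i) ^ 2 ∂β) : β {0} = 0 := by
  have hle : ∀ m : ℕ, 0 < m → β.real {0} ≤ (negDiff (m : ℝ)⁻¹)^[2] f 0 := by
    intro m hm
    have h := hβ m 0 hm
    simp only [Nat.cast_zero, zero_mul, pow_zero] at h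
    rw [h, ← integral_indicator_one (measurableSet_singleton 0)]
    have hy : ∀ y : unitInterval, 0 ≤ (y : ℝ) ^ (m : ℝ)⁻¹ := fun y => Real.rpow_nonneg y.2.1 _
    have h1 : ∀ y : unitInterval, 1 ≤ (∑ i ∈ Finset.range m, ((y : ℝ) ^ (m : ℝ)⁻¹) ^ i) ^ 2 :=
      fun y => one_le_pow₀ (one_le_geom_sum (hy y) hm)
    refine integral_mono_of_nonneg
      (Filter.Eventually.of_forall fun y => Set.indicator_nonneg (fun _ _ => zero_le_one) y)
      (Integrable.of_bound (C := 1) (Measurable.aestronglyMeasurable (by fun_prop))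
        (Filter.Eventually.of_forall fun y => ?_)) (Filter.Eventually.of_forall fun y => ?_)
    · rw [Real.norm_of_nonneg (by positivity)]
      exact div_le_one_of_le₀ (h1 y) (by positivity)
    · by_cases hy0 : y = 0
      · subst hy0
        have hm' : (m : ℝ)⁻¹ ≠ 0 := by positivity
        simp [Real.zero_rpow hm', zero_pow_eq, Finset.sum_ite_eq', hm]
      · rw [Set.indicator_of_notMem (by simpa using hy0)]
        positivity
  have hlim : Filter.Tendsto (fun m : ℕ => (negDiff (m : ℝ)⁻¹)^[2] f 0) Filter.atTop (nhds 0) := by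
    have hs : ∀ c : ℝ, 0 ≤ c → Filter.Tendsto (fun m : ℕ => f (0 + c * (m : ℝ)⁻¹)) Filter.atTop
        (nhds (f 0)) := fun c hc => by
      refine (hf 0 Set.self_mem_Ici).tendsto.comp (tendsto_nhdsWithin_iff.2 ⟨?_,
        Filter.Eventually.of_forall fun m => by rw [Set.mem_Ici]; positivity⟩)
      simpa using ((tendsto_inv_atTop_nhds_zero_nat (𝕜 := ℝ)).const_mul c).const_add 0
    have h := ((tendsto_const_nhds (x := f 0)).sub ((hs 1 zero_le_one).const_mul 2)).add
      (hs 2 zero_le_two)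
    rw [show f 0 - 2 * f 0 + f 0 = 0 by ring] at h
    refine h.congr fun m => ?_
    rw [negDiff_two, one_mul]
  have h0 : β.real {0} ≤ 0 := ge_of_tendsto hlim
    ((Filter.eventually_gt_atTop 0).mono fun m hm => hle m hm)
  exact (measureReal_eq_zero_iff).1 (le_antisymm h0 measureReal_nonneg)

/-- The measure on `(0, ∞)` obtained from a measure on the unit interval by the change of variables
`r = -log y`, normalised so that the second differences of the kernel become geometric sums. -/
lemma exists_levy_measure (β : Measure unitInterval) [IsFiniteMeasure β] :
    ∃ σ : Measure (Set.Ioi (0 : ℝ)), IsFiniteMeasure σ ∧ ∀ m k : ℕ, 0 < m →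
      ∫ r : Set.Ioi (0 : ℝ), (negDiff (m : ℝ)⁻¹)^[2] (kernelDeriv 0 r) (k * (m : ℝ)⁻¹) ∂σ =
        ∫ y in Set.Ioo (0 : unitInterval) 1, ((y : ℝ) ^ (m : ℝ)⁻¹) ^ k /
          (∑ i ∈ Finset.range m, ((y : ℝ) ^ (m : ℝ)⁻¹) ^ i) ^ 2 ∂β := by
  classical
  have hpos : ∀ y : unitInterval,
      0 < if y ∈ Set.Ioo (0 : unitInterval) 1 then -Real.log (y : ℝ) else 1 := by
    intro y
    split_ifs with h
    · exact neg_pos.2 (Real.log_neg h.1 h.2)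
    · exact one_pos
  let φ : unitInterval → Set.Ioi (0 : ℝ) := fun y => ⟨_, hpos y⟩
  have hφ : Measurable φ := by
    refine Measurable.subtype_mk (Measurable.ite measurableSet_Ioo ?_ measurable_const)
    exact (Real.measurable_log.comp measurable_subtype_coe).neg
  let w : unitInterval → ℝ := fun y =>
    (φ y : ℝ) ^ 2 / ((1 + (φ y : ℝ) ^ 2) * (1 - Real.exp (-(φ y : ℝ))) ^ 2)
  have hw : Measurable w := by fun_prop
  have hw0 : ∀ y, 0 ≤ w y := fun y => by positivity
  have hwi : Integrable w (β.restrict (Set.Ioo 0 1)) :=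
    Integrable.of_bound hw.aestronglyMeasurable 2 (Filter.Eventually.of_forall fun y => by
      rw [Real.norm_of_nonneg (hw0 y)]
      exact sq_div_le_two (φ y).2)
  have hfin : IsFiniteMeasure ((β.restrict (Set.Ioo 0 1)).withDensity
      fun y => ENNReal.ofReal (w y)) := isFiniteMeasure_withDensity_ofReal hwi.2
  refine ⟨((β.restrict (Set.Ioo 0 1)).withDensity fun y => ENNReal.ofReal (w y)).map φ,
    Measure.isFiniteMeasure_map _ _, fun m k hm => ?_⟩
  simp only [negDiff_two_kernelDeriv_zero]
  rw [integral_map hφ.aemeasurable (Measurable.aestronglyMeasurable (by fun_prop)),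
    integral_withDensity_eq_integral_toReal_smul (by fun_prop)
      (Filter.Eventually.of_forall fun _ => ENNReal.ofReal_lt_top)]
  refine setIntegral_congr_fun measurableSet_Ioo fun y hy => ?_
  have hy0 : (0 : ℝ) < y := hy.1
  have hy1 : (y : ℝ) < 1 := hy.2
  have hφy : (φ y : ℝ) = -Real.log y := if_pos hy
  have hr : 0 < -Real.log (y : ℝ) := neg_pos.2 (Real.log_neg hy0 hy1)
  set x := (y : ℝ) ^ (m : ℝ)⁻¹ with hx
  have hx0 : 0 ≤ x := Real.rpow_nonneg hy0.le _
  have hxm : x ^ m = y := Real.rpow_inv_natCast_pow hy0.le hm.ne'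
  have hexp : Real.exp (Real.log y * (m : ℝ)⁻¹) = x := (Real.rpow_def_of_pos hy0 _).symm
  have hexpk : Real.exp (Real.log y * (k * (m : ℝ)⁻¹)) = x ^ k := by
    rw [← hexp, ← Real.exp_nat_mul]
    ring_nf
  have hgeom : 1 - (y : ℝ) = (∑ i ∈ Finset.range m, x ^ i) * (1 - x) := by
    rw [geom_sum_mul_neg, hxm]
  have h1x : 1 - x ≠ 0 := by
    intro h
    rw [h, mul_zero] at hgeom
    linarith
  have hS := one_le_geom_sum hx0 hm
  simp only [ENNReal.toReal_ofReal (hw0 y)]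
  simp only [smul_eq_mul, w, hφy, neg_neg, Real.exp_log hy0, hexp, hexpk, hgeom]
  have hl : Real.log (y : ℝ) ≠ 0 := by linarith
  field_simp

/-- A continuous function whose higher differences are nonnegative has the integral
representation. -/
theorem hasLevyRep_of_iterate_negDiff_nonneg {f : ℝ → ℝ} (hf : ContinuousOn f (Set.Ici 0))
    (hD : ∀ (n : ℕ) (h t : ℝ), 0 < h → 0 < t → 0 ≤ (negDiff h)^[n + 2] f t) : HasLevyRep f := by
  obtain ⟨β, hβ, hfβ⟩ := exists_measure_second_difference fun n h t hh ht =>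
    iterate_negDiff_nonneg_of_pos hf hh.le (fun s hs => hD n h s hh hs) ht
  obtain ⟨σ, hσ, hσβ⟩ := exists_levy_measure β
  have hβ0 := measure_zero_of_second_difference hf hfβ
  let q : ℝ → ℝ := fun t =>
    f t - β.real {1} / 2 * t ^ 2 - ∫ r : Set.Ioi (0 : ℝ), kernelDeriv 0 r t ∂σ
  have hq : ContinuousOn q (Set.Ici 0) :=
    (hf.sub (by fun_prop)).sub (continuousOn_integral_kernelDeriv_zero σ)
  have hq0 : ∀ m k : ℕ, 0 < m → (negDiff (m : ℝ)⁻¹)^[2] q (k * (m : ℝ)⁻¹) = 0 := by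
    intro m k hm
    have hi : ∀ t, 0 ≤ t → Integrable (fun r : Set.Ioi (0 : ℝ) => kernelDeriv 0 r t) σ :=
      fun t ht => integrable_kernelDeriv_zero σ ht
    have hK : (negDiff (m : ℝ)⁻¹)^[2] (fun t => ∫ r : Set.Ioi (0 : ℝ), kernelDeriv 0 r t ∂σ)
        (k * (m : ℝ)⁻¹) = ∫ r : Set.Ioi (0 : ℝ),
          (negDiff (m : ℝ)⁻¹)^[2] (kernelDeriv 0 r) (k * (m : ℝ)⁻¹) ∂σ := by
      simp only [negDiff_two]
      rw [integral_add, integral_sub, integral_const_mul]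
      · exact hi _ (by positivity)
      · exact (hi _ (by positivity)).const_mul 2
      · exact (hi _ (by positivity)).sub ((hi _ (by positivity)).const_mul 2)
      · exact hi _ (by positivity)
    have hsplit := hfβ m k hm
    have hInt : Integrable (fun y : unitInterval => ((y : ℝ) ^ (m : ℝ)⁻¹) ^ k /
        (∑ i ∈ Finset.range m, ((y : ℝ) ^ (m : ℝ)⁻¹) ^ i) ^ 2) β := by
      refine Integrable.of_bound (Measurable.aestronglyMeasurable (by fun_prop)) 1
        (Filter.Eventually.of_forall fun y => ?_)
      have hy : 0 ≤ (y : ℝ) ^ (m : ℝ)⁻¹ := Real.rpow_nonneg y.2.1 _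
      have hy1 : (y : ℝ) ^ (m : ℝ)⁻¹ ≤ 1 := Real.rpow_le_one y.2.1 y.2.2 (by positivity)
      rw [Real.norm_of_nonneg (by positivity)]
      exact div_le_one_of_le₀ ((pow_le_one₀ hy hy1).trans
        (one_le_pow₀ (one_le_geom_sum hy hm))) (by positivity)
    have hae : (Set.univ : Set unitInterval) =ᵐ[β] (Set.Ioo 0 1 ∪ {1} : Set unitInterval) := by
      have h0 : ∀ᵐ y ∂β, y ≠ 0 := by
        rw [ae_iff]
        simpa using hβ0
      filter_upwards [h0] with y hy
      refine propext ⟨fun _ => ?_, fun _ => trivial⟩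
      rcases eq_or_ne y 1 with h1 | h1
      · exact Or.inr h1
      · exact Or.inl ⟨lt_of_le_of_ne unitInterval.nonneg' hy.symm,
          lt_of_le_of_ne unitInterval.le_one' h1⟩
    rw [← setIntegral_univ, setIntegral_congr_set hae, setIntegral_union (by simp)
      (measurableSet_singleton 1) hInt.integrableOn hInt.integrableOn, ← hσβ m k hm, ← hK,
      integral_singleton] at hsplit
    simp only [Set.Icc.coe_one, Real.one_rpow, one_pow, Finset.sum_const, Finset.card_range,
      nsmul_eq_mul, mul_one, smul_eq_mul] at hsplit
    rw [negDiff_two, negDiff_two] at hsplit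
    rw [negDiff_two]
    simp only [q]
    have e : (1 : ℝ) / (m : ℝ) ^ 2 = (m : ℝ)⁻¹ ^ 2 := by rw [inv_pow, one_div]
    rw [e] at hsplit
    linear_combination hsplit
  refine ⟨q 0, q 1 - q 0, β.real {1} / 2, σ, by positivity, hσ, fun t ht => ?_⟩
  rw [← eq_affine_of_second_difference_eq_zero hq hq0 ht]
  simp only [q]
  ring

/-- equivalence between PDI kernels `f(‖x-y‖² + ‖u-v‖²)` on all Euclidean
spaces and completely monotone functions of order 2. Here `ω₂(s) = 1 - s` and
`e₂(s) = e^{-s}(1 + s)`. -/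
theorem stmt11 (f : ℝ → ℝ) (hf : ContinuousOn f (Set.Ici 0)) :
    ((∀ d d' : ℕ,
        IsPDI (fun p q : EuclideanSpace ℝ (Fin d) × EuclideanSpace ℝ (Fin d') =>
          f (‖p.1 - q.1‖ ^ 2 + ‖p.2 - q.2‖ ^ 2) - f (‖p.2 - q.2‖ ^ 2)
            - f (‖p.1 - q.1‖ ^ 2) + f 0))
      ↔ (∀ d d' : ℕ,
        IsPDI (fun p q : EuclideanSpace ℝ (Fin d) × EuclideanSpace ℝ (Fin d') =>
          f (‖p.1 - q.1‖ ^ 2 + ‖p.2 - q.2‖ ^ 2)))) ∧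
    ((∀ d d' : ℕ,
        IsPDI (fun p q : EuclideanSpace ℝ (Fin d) × EuclideanSpace ℝ (Fin d') =>
          f (‖p.1 - q.1‖ ^ 2 + ‖p.2 - q.2‖ ^ 2)))
      ↔ ∃ (a₀ a₁ a₂ : ℝ) (σ : Measure (Set.Ioi (0 : ℝ))),
          0 ≤ a₂ ∧ IsFiniteMeasure σ ∧
          ∀ t : ℝ, 0 ≤ t →
            f t = a₀ + a₁ * t + a₂ * t ^ 2 +
              ∫ r, (Real.exp (-(r : ℝ) * t) -
                  (Real.exp (-(r : ℝ)) * (1 + (r : ℝ))) * (1 - (r : ℝ) * t)) *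
                ((1 + (r : ℝ) ^ 2) / (r : ℝ) ^ 2) ∂σ) ∧
    ((∃ (a₀ a₁ a₂ : ℝ) (σ : Measure (Set.Ioi (0 : ℝ))),
        0 ≤ a₂ ∧ IsFiniteMeasure σ ∧
        ∀ t : ℝ, 0 ≤ t →
          f t = a₀ + a₁ * t + a₂ * t ^ 2 +
            ∫ r, (Real.exp (-(r : ℝ) * t) -
                (Real.exp (-(r : ℝ)) * (1 + (r : ℝ))) * (1 - (r : ℝ) * t)) *
              ((1 + (r : ℝ) ^ 2) / (r : ℝ) ^ 2) ∂σ)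
      ↔ (ContDiffOn ℝ ((⊤ : ℕ∞) : WithTop ℕ∞) f (Set.Ioi 0) ∧
          ∀ (n : ℕ) (t : ℝ), 0 < t →
            0 ≤ (-1 : ℝ) ^ n * iteratedDeriv (n + 2) f t)) := by
  refine ⟨radialPDI_of_second_difference, ⟨fun h => ?_, HasLevyRep.radialPDI⟩,
    ⟨HasLevyRep.contDiffOn_and_sign, fun h => ?_⟩⟩
  · exact hasLevyRep_of_iterate_negDiff_nonneg hf fun n s t hs ht =>
      RadialPDI.iterate_negDiff_nonneg h n hs.le ht.le
  · refine hasLevyRep_of_iterate_negDiff_nonneg hf fun n s t hs ht => ?_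
    have := iterate_negDiff_nonneg_of_hasDerivAt (F := fun n => iteratedDeriv n f)
      (fun n t ht => hasDerivAt_iteratedDeriv_of_contDiffOn h.1 n ht) h.2 n hs ht
    simpa only [iteratedDeriv_zero] using this
end
end

section
/- Let X and Y be nonempty sets and 𝔍 : (X×Y)×(X×Y) → ℝ a symmetric kernel. Define the kernel K_𝔍 : (X×Y)²×(X×Y)² → ℝ by K_𝔍([x,y,z,w],[x',y',z',w']) := ∑_{i,j,k,l ∈ {0,1}} (−1)^{i+j+k+l} 𝔍((u_i, v_j),(u'_k, v'_l)), where u_0 = x, u_1 = z, v_0 = y, v_1 = w, u'_0 = x', u'_1 = z', v'_0 = y', v'_1 = w' (the 16-term alternating sum). Then K_𝔍 is positive definite if and only if 𝔍 is positive definite independent. -/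
open Finset

/-- A symmetric kernel `K : Z × Z → ℝ` is positive definite (PD). -/
def IsPD {Z : Type*} (K : Z → Z → ℝ) : Prop :=
  ∀ (n : ℕ) (z : Fin n → Z) (c : Fin n → ℝ),
    0 ≤ ∑ i, ∑ j, c i * c j * K (z i) (z j)

/-- Positive definiteness tested on families indexed by an arbitrary finite type. -/
theorem IsPD.sum_nonneg {Z ι : Type*} [Fintype ι] {K : Z → Z → ℝ} (hK : IsPD K)
    (z : ι → Z) (c : ι → ℝ) : 0 ≤ ∑ i, ∑ j, c i * c j * K (z i) (z j) := by
  let e := (Fintype.equivFin ι).symm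
  have h := hK _ (z ∘ e) (c ∘ e)
  simp only [Function.comp_apply] at h
  rw [← e.sum_comp]
  simp_rw [← e.sum_comp (fun j => c _ * c j * K (z _) (z j))]
  exact h

/-- The PDI inequality tested on families indexed by arbitrary finite types. -/
theorem IsPDI.sum_nonneg {X Y ι κ : Type*} [Fintype ι] [Fintype κ] {J : X × Y → X × Y → ℝ}
    (hJ : IsPDI J) (x : ι → X) (y : κ → Y) (c : ι → κ → ℝ)
    (hcol : ∀ k, ∑ i, c i k = 0) (hrow : ∀ i, ∑ k, c i k = 0) :
    0 ≤ ∑ i, ∑ j, ∑ k, ∑ l, c i k * c j l * J (x i, y k) (x j, y l) := by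
  let e := (Fintype.equivFin ι).symm
  let f := (Fintype.equivFin κ).symm
  have h := hJ _ _ (x ∘ e) (y ∘ f) (fun i k => c (e i) (f k))
    (fun k => (e.sum_comp fun i => c i (f k)).trans (hcol _))
    (fun i => (f.sum_comp fun k => c (e i) k).trans (hrow _))
  simp only [Function.comp_apply] at h
  rw [← e.sum_comp]
  simp_rw [← e.sum_comp (fun j => ∑ k, ∑ l, c _ k * c j l * J (x _, y k) (x j, y l)),
    ← f.sum_comp (fun k => ∑ l, c _ k * c _ l * J (x _, y k) (x _, y l)),
    ← f.sum_comp (fun l => c _ _ * c _ l * J (x _, y _) (x _, y l))]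
  exact h

/-- Weights with vanishing marginals annihilate functions of a single coordinate. -/
theorem sum_mul_eq_of_marginals_eq_zero {ι κ : Type*} [Fintype ι] [Fintype κ] {c : ι → κ → ℝ}
    (hcol : ∀ k, ∑ i, c i k = 0) (hrow : ∀ i, ∑ k, c i k = 0)
    (f : ι → κ → ℝ) (g : κ → ℝ) (h : ι → ℝ) (e : ℝ) :
    ∑ a : ι × κ, c a.1 a.2 * (f a.1 a.2 - g a.2 - h a.1 + e) =
      ∑ a : ι × κ, c a.1 a.2 * f a.1 a.2 := by
  have hg : ∑ a : ι × κ, c a.1 a.2 * g a.2 = 0 := by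
    rw [Fintype.sum_prod_type_right]
    simp [← Finset.sum_mul, hcol]
  have hh : ∑ a : ι × κ, c a.1 a.2 * h a.1 = 0 := by
    rw [Fintype.sum_prod_type]
    simp [← Finset.sum_mul, hrow]
  have he : ∑ a : ι × κ, c a.1 a.2 * e = 0 := by
    rw [Fintype.sum_prod_type]
    simp [← Finset.sum_mul, hrow]
  simp only [mul_add, mul_sub, Finset.sum_add_distrib, Finset.sum_sub_distrib, hg, hh, he]
  ring

/-- the 16-term alternating-sum kernel `K_𝔍` on `(X × Y)² × (X × Y)²`,
with `p = ((x,y),(z,w))` and `q = ((x',y'),(z',w'))`, is positive definite iff `𝔍` is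
positive definite independent. -/
theorem stmt18 {X Y : Type*} [Nonempty X] [Nonempty Y]
    (J : X × Y → X × Y → ℝ) (hsym : ∀ p q, J p q = J q p) :
    IsPD (fun p q : (X × Y) × (X × Y) =>
      J (p.1.1, p.1.2) (q.1.1, q.1.2) - J (p.2.1, p.1.2) (q.1.1, q.1.2)
        - J (p.1.1, p.2.2) (q.1.1, q.1.2) + J (p.2.1, p.2.2) (q.1.1, q.1.2)
      - J (p.1.1, p.1.2) (q.2.1, q.1.2) + J (p.2.1, p.1.2) (q.2.1, q.1.2)
        + J (p.1.1, p.2.2) (q.2.1, q.1.2) - J (p.2.1, p.2.2) (q.2.1, q.1.2)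
      - J (p.1.1, p.1.2) (q.1.1, q.2.2) + J (p.2.1, p.1.2) (q.1.1, q.2.2)
        + J (p.1.1, p.2.2) (q.1.1, q.2.2) - J (p.2.1, p.2.2) (q.1.1, q.2.2)
      + J (p.1.1, p.1.2) (q.2.1, q.2.2) - J (p.2.1, p.1.2) (q.2.1, q.2.2)
        - J (p.1.1, p.2.2) (q.2.1, q.2.2) + J (p.2.1, p.2.2) (q.2.1, q.2.2))
    ↔ IsPDI J := by
  constructor
  · intro hK n m x y c hcol hrow
    obtain ⟨x₀⟩ := ‹Nonempty X›
    obtain ⟨y₀⟩ := ‹Nonempty Y›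
    have h := hK.sum_nonneg (fun a : Fin n × Fin m => ((x a.1, y a.2), (x₀, y₀)))
      (fun a => c a.1 a.2)
    let D : X × Y → Fin n → Fin m → ℝ := fun q i k =>
      J (x i, y k) q - J (x₀, y k) q - J (x i, y₀) q + J (x₀, y₀) q
    have hD : ∀ q, ∑ a : Fin n × Fin m, c a.1 a.2 * D q a.1 a.2 =
        ∑ a : Fin n × Fin m, c a.1 a.2 * J (x a.1, y a.2) q := fun q =>
      sum_mul_eq_of_marginals_eq_zero hcol hrow (fun i k => J (x i, y k) q)
        (fun k => J (x₀, y k) q) (fun i => J (x i, y₀) q) (J (x₀, y₀) q)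
    refine h.trans_eq ?_
    calc _ = ∑ a : Fin n × Fin m, c a.1 a.2 * ∑ b : Fin n × Fin m, c b.1 b.2 *
            (D (x b.1, y b.2) a.1 a.2 - D (x₀, y b.2) a.1 a.2
              - D (x b.1, y₀) a.1 a.2 + D (x₀, y₀) a.1 a.2) := by
          refine Finset.sum_congr rfl fun a _ => ?_
          rw [Finset.mul_sum]
          refine Finset.sum_congr rfl fun b _ => ?_
          simp only [D]
          ring
      _ = ∑ a : Fin n × Fin m, c a.1 a.2 * ∑ b : Fin n × Fin m, c b.1 b.2 *
            D (x b.1, y b.2) a.1 a.2 := by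
          refine Finset.sum_congr rfl fun a _ => ?_
          rw [sum_mul_eq_of_marginals_eq_zero hcol hrow (fun i k => D (x i, y k) a.1 a.2)
            (fun k => D (x₀, y k) a.1 a.2) (fun i => D (x i, y₀) a.1 a.2)]
      _ = ∑ b : Fin n × Fin m, c b.1 b.2 * ∑ a : Fin n × Fin m, c a.1 a.2 *
            D (x b.1, y b.2) a.1 a.2 := by
          simp_rw [Finset.mul_sum]
          rw [Finset.sum_comm]
          simp_rw [mul_left_comm]
      _ = ∑ b : Fin n × Fin m, c b.1 b.2 * ∑ a : Fin n × Fin m, c a.1 a.2 *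
            J (x b.1, y b.2) (x a.1, y a.2) := by
          refine Finset.sum_congr rfl fun b _ => ?_
          rw [hD]
          exact congrArg _ (Finset.sum_congr rfl fun a _ => by rw [hsym])
      _ = _ := by
          simp_rw [Finset.mul_sum, Fintype.sum_prod_type, mul_assoc]
          exact Finset.sum_congr rfl fun i _ => Finset.sum_comm
  · intro hJ N z c
    let s : Bool → ℝ := fun b => if b then -1 else 1
    have h := hJ.sum_nonneg
      (fun a : Fin N × Bool => if a.2 then (z a.1).2.1 else (z a.1).1.1)
      (fun b : Fin N × Bool => if b.2 then (z b.1).2.2 else (z b.1).1.2)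
      (fun a b => if a.1 = b.1 then c a.1 * s a.2 * s b.2 else 0)
      (fun b => by simp [Fintype.sum_prod_type_right, s])
      (fun a => by simp [Fintype.sum_prod_type_right, s])
    refine h.trans_eq ?_
    simp only [Fintype.sum_prod_type, Fintype.sum_bool, s, ite_mul, mul_ite, zero_mul, mul_zero,
      Finset.sum_add_distrib, Finset.sum_ite_eq, Finset.mem_univ, if_true, Bool.false_eq_true,
      if_false]
    simp only [← Finset.sum_add_distrib]
    refine Finset.sum_congr rfl fun i _ => Finset.sum_congr rfl fun j _ => ?_
    ring
end

section
/- Let X be a Hausdorff topological space and σ_{i,j} ∈ 𝔐(X), 1 ≤ i,j ≤ n, be measures such that: σ_{i,i} is the zero measure for every i; σ_{i,j} = σ_{j,i} for all i,j; and for every real c_1,…,c_n with ∑_{i=1}^n c_i = 0, the measure −∑_{i,j=1}^n c_i c_j σ_{i,j} is nonnegative. Then, with σ_S := ∑_{i,j=1}^n σ_{i,j}: the measure σ_S is nonnegative; there exist functions g_{i,j} ∈ L¹(σ_S), 1 ≤ i,j ≤ n, with dσ_{i,j} = g_{i,j} dσ_S; and the g_{i,j} can be chosen so that for every r ∈ X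 the n×n matrix [g_{i,j}(r)] is conditionally negative definite with g_{i,i}(r) = 0 for every i. -/
open MeasureTheory Set Finset

noncomputable section

/-- Testing conditional negative definiteness against `e_i - e_j` shows that a symmetric
conditionally negative definite matrix with zero diagonal has nonnegative entries. -/
lemma entry_nonneg_of_condNegDef {n : ℕ} (a : Fin n → Fin n → ℝ)
    (hdiag : ∀ i, a i i = 0) (hsym : ∀ i j, a i j = a j i)
    (hcnd : ∀ c : Fin n → ℝ, (∑ i, c i) = 0 → ∑ i, ∑ j, c i * c j * a i j ≤ 0)
    (i j : Fin n) : 0 ≤ a i j := by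
  have h := hcnd (Pi.single i 1 - Pi.single j 1) (by simp)
  have hexp : ∑ k, ∑ l, (Pi.single i 1 - Pi.single j 1 : Fin n → ℝ) k *
      (Pi.single i 1 - Pi.single j 1 : Fin n → ℝ) l * a k l
      = a i i - a i j - (a j i - a j j) := by
    simp [Pi.single_apply, sub_mul, Finset.sum_sub_distrib]
  rw [hexp, hdiag, hdiag, hsym j i] at h
  linarith

/-- Conditional negative definiteness only has to be tested on the centerings of the vectors
of a dense sequence. -/
lemma condNegDef_of_denseSeq {n : ℕ} (a : Fin n → Fin n → ℝ)
    (h : ∀ m : ℕ, ∑ i, ∑ j,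
      (TopologicalSpace.denseSeq (Fin n → ℝ) m i
        - (∑ k, TopologicalSpace.denseSeq (Fin n → ℝ) m k) / n) *
      (TopologicalSpace.denseSeq (Fin n → ℝ) m j
        - (∑ k, TopologicalSpace.denseSeq (Fin n → ℝ) m k) / n) * a i j ≤ 0)
    (c : Fin n → ℝ) (hc : (∑ i, c i) = 0) : ∑ i, ∑ j, c i * c j * a i j ≤ 0 := by
  have hclosed : IsClosed {d : Fin n → ℝ |
      ∑ i, ∑ j, (d i - (∑ k, d k) / n) * (d j - (∑ k, d k) / n) * a i j ≤ 0} :=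
    isClosed_le (by fun_prop) continuous_const
  have key := (TopologicalSpace.denseRange_denseSeq (Fin n → ℝ)).induction_on
    (p := fun d : Fin n → ℝ =>
      ∑ i, ∑ j, (d i - (∑ k, d k) / n) * (d j - (∑ k, d k) / n) * a i j ≤ 0) c hclosed h
  simpa [hc] using key

lemma sum_centered_eq_zero {n : ℕ} (d : Fin n → ℝ) : ∑ i, (d i - (∑ k, d k) / n) = 0 := by
  rcases Nat.eq_zero_or_pos n with rfl | hn
  · simp
  · have : (n : ℝ) ≠ 0 := by positivity
    simp [Finset.sum_sub_distrib, mul_div_cancel₀, this]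

/-- a matrix of signed measures that is "conditionally negative definite" has a
common dominating nonnegative measure `σ_S = ∑ σ_{i,j}` and densities `g_{i,j}` forming, at
each point, a conditionally negative definite matrix with zero diagonal. -/
theorem stmt19 {X : Type*} [TopologicalSpace X] [T2Space X] [MeasurableSpace X] [BorelSpace X]
    (n : ℕ) (σ : Fin n → Fin n → SignedMeasure X)
    (hdiag : ∀ i, σ i i = 0)
    (hsym : ∀ i j, σ i j = σ j i)
    (hcnd : ∀ c : Fin n → ℝ, (∑ i, c i) = 0 →
      ∀ A : Set X, MeasurableSet A → ∑ i, ∑ j, c i * c j * (σ i j) A ≤ 0) :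
    (∀ A : Set X, MeasurableSet A → 0 ≤ (∑ k, ∑ l, σ k l) A) ∧
    ∃ g : Fin n → Fin n → X → ℝ,
      (∀ i j, Integrable (g i j) (∑ k, ∑ l, σ k l).totalVariation) ∧
      (∀ (i j : Fin n) (A : Set X), MeasurableSet A →
        (σ i j) A = ∫ x in A, g i j x ∂(∑ k, ∑ l, σ k l).totalVariation) ∧
      (∀ (r : X) (i : Fin n), g i i r = 0) ∧
      (∀ (r : X) (i j : Fin n), g i j r = g j i r) ∧
      (∀ (r : X) (c : Fin n → ℝ), (∑ i, c i) = 0 →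
        ∑ i, ∑ j, c i * c j * g i j r ≤ 0) := by
  classical
  have hnonneg (A : Set X) (hA : MeasurableSet A) (i j : Fin n) : 0 ≤ σ i j A :=
    entry_nonneg_of_condNegDef (fun i j => σ i j A) (by simp [hdiag])
      (fun i j => by rw [hsym]) (fun c hc => hcnd c hc A hA) i j
  have hsum (A : Set X) : (∑ k, ∑ l, σ k l) A = ∑ k, ∑ l, σ k l A := by
    have happly (s : Fin n → SignedMeasure X) : (∑ k, s k) A = ∑ k, s k A := by
      rw [← FunLike.coeAddMonoidHom_apply, map_sum, Finset.sum_apply]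
      rfl
    simp only [happly]
  refine ⟨fun A hA => ?_, ?_⟩
  · rw [hsum]
    exact Finset.sum_nonneg fun k _ => Finset.sum_nonneg fun l _ => hnonneg A hA k l
  set S : SignedMeasure X := ∑ k, ∑ l, σ k l with hS
  set μ := S.totalVariation with hμ
  have hfin : IsFiniteMeasure μ := by rw [hμ, SignedMeasure.totalVariation]; infer_instance
  have hac (i j : Fin n) : VectorMeasure.AbsolutelyContinuous (σ i j)
      μ.toENNRealVectorMeasure := by
    refine VectorMeasure.AbsolutelyContinuous.mk fun A hA hA0 => ?_
    rw [Measure.toENNRealVectorMeasure_apply_measurable hA] at hA0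
    have hSA := SignedMeasure.null_of_totalVariation_zero S hA0
    rw [hsum, Finset.sum_eq_zero_iff_of_nonneg
      fun k _ => Finset.sum_nonneg fun l _ => hnonneg A hA k l] at hSA
    exact (Finset.sum_eq_zero_iff_of_nonneg fun l _ => hnonneg A hA i l).1
      (hSA i (Finset.mem_univ i)) j (Finset.mem_univ j)
  set f : Fin n → Fin n → X → ℝ := fun i j => (σ i j).rnDeriv μ with hf
  have hint (i j : Fin n) : Integrable (f i j) μ := SignedMeasure.integrable_rnDeriv _ _
  have hdens (i j : Fin n) (A : Set X) (hA : MeasurableSet A) :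
      σ i j A = ∫ x in A, f i j x ∂μ := by
    rw [← withDensityᵥ_apply (hint i j) hA,
      (SignedMeasure.absolutelyContinuous_iff_withDensityᵥ_rnDeriv_eq _ _).1 (hac i j)]
  have hle (c : Fin n → ℝ) (hc : (∑ i, c i) = 0) :
      ∀ᵐ x ∂μ, ∑ i, ∑ j, c i * c j * f i j x ≤ 0 := by
    have hi (i j : Fin n) : Integrable (fun x => c i * c j * f i j x) μ :=
      (hint i j).const_mul _
    have hi' (i : Fin n) : Integrable (fun x => ∑ j, c i * c j * f i j x) μ :=
      integrable_finsetSum _ fun j _ => hi i j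
    have h := ae_nonneg_of_forall_setIntegral_nonneg
      (f := fun x => -∑ i, ∑ j, c i * c j * f i j x)
      (integrable_finsetSum _ fun i _ => hi' i).neg fun A hA _ => by
        rw [integral_neg, integral_finsetSum _ fun i _ => (hi' i).integrableOn]
        simp_rw [fun i => integral_finsetSum (μ := μ.restrict A) Finset.univ
          fun j _ => (hi i j).integrableOn, integral_const_mul, ← hdens _ _ A hA]
        exact neg_nonneg.2 (hcnd c hc A hA)
    filter_upwards [h] with x hx
    exact neg_nonneg.1 hx
  have hzero (i : Fin n) : ∀ᵐ x ∂μ, f i i x = 0 := by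
    refine (hint i i).ae_eq_of_forall_setIntegral_eq _ (fun _ => 0) (integrable_zero _ _ _)
      fun A hA _ => ?_
    rw [← hdens i i A hA, hdiag]
    simp
  let P : X → Prop := fun x => (∀ i, f i i x = 0) ∧
    ∀ c : Fin n → ℝ, (∑ i, c i) = 0 → ∑ i, ∑ j, c i * c j * f i j x ≤ 0
  have hP : ∀ᵐ x ∂μ, P x := by
    have h := ae_all_iff.2 fun m : ℕ => hle _
      (sum_centered_eq_zero (TopologicalSpace.denseSeq (Fin n → ℝ) m))
    filter_upwards [ae_all_iff.2 hzero, h] with x hx0 hx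
    exact ⟨hx0, condNegDef_of_denseSeq (fun i j => f i j x) hx⟩
  have hae (i j : Fin n) : f i j =ᵐ[μ] fun x => if P x then f i j x else 0 := by
    filter_upwards [hP] with x hx
    rw [if_pos hx]
  refine ⟨fun i j x => if P x then f i j x else 0, fun i j => (hint i j).congr (hae i j),
    fun i j A hA => ?_, fun r i => ?_, fun r i j => ?_, fun r c hc => ?_⟩
  · rw [hdens i j A hA]
    exact integral_congr_ae (ae_restrict_of_ae (hae i j))
  · by_cases hr : P r
    · simpa [hr] using hr.1 i
    · simp [hr]
  · simp only [hf, hsym i j]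
  · by_cases hr : P r
    · simpa [hr] using hr.2 c hc
    · simp [hr]
end
end
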